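/- Let 𝔤 be a finite-dimensional semisimple Lie algebra over an algebraically closed field k of characteristic 0, with Cartan subalgebra 𝔥, root system R, base Π, positive roots R_+, and Borel subalgebra 𝔟 = 𝔥 ⊕ (⊕_{α ∈ R_+} 𝔤^α). Then the index of 𝔟 equals rk(𝔤) − k_𝔤, where rk(𝔤) = dim 𝔥 is the rank of 𝔤 and k_𝔤 = |𝒦(Π)| is the cardinality of the cascade. That is, χ(𝔟) = min_{f ∈ 𝔟*} dim 𝔟^f = dim 𝔥 − |𝒦(Π)|. -/

import Mathlib

open Finset Module

open scoped Classical

/-- A reduced crystallographic root system in the `k`-vector space `V`, recorded through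
the finite set `roots` of roots, the coroot linear forms `corootForm α = ⟨·, α^∨⟩`, and
the integer Cartan pairing `pairInt β α = ⟨β, α^∨⟩ ∈ ℤ` (meaningful when `α, β` are roots). -/
structure RootSystemData (k V : Type*) [Field k] [CharZero k]
    [AddCommGroup V] [Module k V] where
  /-- the (finite) set of roots -/
  roots : Finset V
  /-- `corootForm α` is the linear form `⟨·, α^∨⟩` associated to the coroot of a root `α` -/
  corootForm : V → V →ₗ[k] k
  /-- the integer `⟨β, α^∨⟩`, recorded as `pairInt β α` -/
  pairInt : V → V → ℤ
  ne_zero : ∀ α ∈ roots, α ≠ (0 : V)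
  span_eq_top : Submodule.span k (roots : Set V) = ⊤
  pair_compat : ∀ α ∈ roots, ∀ β ∈ roots, ((pairInt β α : ℤ) : k) = corootForm α β
  pair_self : ∀ α ∈ roots, pairInt α α = 2
  reflect_mem : ∀ α ∈ roots, ∀ β ∈ roots, β - pairInt β α • α ∈ roots
  reduced : ∀ α ∈ roots, ∀ c : k, c • α ∈ roots → c = 1 ∨ c = -1

namespace RootSystemData

variable {k V : Type*} [Field k] [CharZero k] [AddCommGroup V] [Module k V]
variable (P : RootSystemData k V)

/-- A base (set of simple roots) of the root system: a linearly independent set of roots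
such that every root is a nonnegative or nonpositive integral combination of its elements. -/
structure IsBase (B : Finset V) : Prop where
  subset : B ⊆ P.roots
  indep : LinearIndependent k (fun b : B => (b : V))
  pos_or_neg : ∀ α ∈ P.roots,
    α ∈ AddSubmonoid.closure (B : Set V) ∨ -α ∈ AddSubmonoid.closure (B : Set V)

/-- The positive roots `R₊` with respect to a base `B`. -/
noncomputable def posRoots (B : Finset V) : Finset V :=
  P.roots.filter fun α => α ∈ AddSubmonoid.closure (B : Set V)

/-- `R^S = R ∩ ℤS`. -/
noncomputable def rootsOf (S : Finset V) : Finset V :=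
  P.roots.filter fun α => α ∈ AddSubgroup.closure (S : Set V)

/-- `R₊^S = R ∩ ℕS`. -/
noncomputable def posRootsOf (S : Finset V) : Finset V :=
  P.roots.filter fun α => α ∈ AddSubmonoid.closure (S : Set V)

/-- Two simple roots are linked in the Dynkin diagram of `S ⊆ Π` when they can be joined
by a chain in `S` of consecutively non-orthogonal elements. -/
def Linked (S : Finset V) : V → V → Prop :=
  Relation.ReflTransGen fun a b => a ∈ S ∧ b ∈ S ∧ P.pairInt a b ≠ 0

/-- A subset of a base is connected if its Dynkin diagram is connected (and nonempty). -/
def IsConnected (S : Finset V) : Prop :=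
  S.Nonempty ∧ ∀ a ∈ S, ∀ b ∈ S, P.Linked S a b

/-- `ε` is the highest root of `R^S`: a positive root of `R^S` such that `ε - α ∈ ℕS`
for every root `α ∈ R^S`. -/
def IsHighestRoot (S : Finset V) (ε : V) : Prop :=
  ε ∈ P.posRootsOf S ∧ ∀ α ∈ P.rootsOf S, ε - α ∈ AddSubmonoid.closure (S : Set V)

/-- The highest root `ε_S` of `R^S` (junk value `0` if it does not exist). -/
noncomputable def highestRoot (S : Finset V) : V :=
  if h : ∃ ε, P.IsHighestRoot S ε then h.choose else 0

/-- The connected component of `a` in the Dynkin diagram of `S`. -/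
noncomputable def component (S : Finset V) (a : V) : Finset V :=
  S.filter fun b => P.Linked S a b

/-- The connected components of the Dynkin diagram of `S`. -/
noncomputable def components (S : Finset V) : Finset (Finset V) :=
  S.image fun a => P.component S a

/-- `{α ∈ S : ⟨α, ε_S^∨⟩ = 0}`. -/
noncomputable def zeroPart (S : Finset V) : Finset V :=
  S.filter fun a => P.pairInt a (P.highestRoot S) = 0

/-- Fuel-based auxiliary recursion for the cascade `𝒦(S)`; for an actual root system the
recursion terminates in at most `card S` steps, so fuel `card S + 1` computes `𝒦(S)`. -/
noncomputable def cascadeAux : ℕ → Finset V → Finset (Finset V)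
  | 0, _ => ∅
  | n + 1, S => (P.components S).biUnion fun C => insert C (cascadeAux n (P.zeroPart C))

/-- The cascade `𝒦(S)`, defined recursively by `𝒦(∅) = ∅`,
`𝒦(S) = 𝒦(S₁) ∪ ⋯ ∪ 𝒦(S_r)` if `S` has connected components `S₁, …, S_r`, and
`𝒦(S) = {S} ∪ 𝒦({α ∈ S : ⟨α, ε_S^∨⟩ = 0})` if `S` is connected. -/
noncomputable def cascade (S : Finset V) : Finset (Finset V) :=
  P.cascadeAux (S.card + 1) S

/-- `Γ^K = {α ∈ R^K : ⟨α, ε_K^∨⟩ > 0}`. -/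
noncomputable def gamma (K : Finset V) : Finset V :=
  (P.rootsOf K).filter fun α => 0 < P.pairInt α (P.highestRoot K)

end RootSystemData

/-- For a Lie subalgebra `𝔮` of a Lie algebra and a linear form `f ∈ 𝔮*`, the subspace
`𝔮^f = {x ∈ 𝔮 : f ⁅x, y⁆ = 0 for all y ∈ 𝔮}`. -/
def lieSubFix {k g : Type*} [Field k] [LieRing g] [LieAlgebra k g]
    (q : LieSubalgebra k g) (f : Module.Dual k q) : Submodule k q where
  carrier := {x : q | ∀ y : q, f ⁅x, y⁆ = 0}
  add_mem' := fun hx hy z => by rw [add_lie, map_add, hx z, hy z, add_zero]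
  zero_mem' := fun z => by rw [zero_lie, map_zero]
  smul_mem' := fun c x hx z => by rw [smul_lie, map_smul, hx z, smul_zero]

/-- The alternating form `(x, y) ↦ f ⁅x, y⁆`. -/
noncomputable def lieForm {k L : Type*} [Field k] [LieRing L] [LieAlgebra k L]
    (f : Dual k L) : LinearMap.BilinForm k L :=
  LinearMap.mk₂ k (fun x y => f ⁅x, y⁆) (by simp) (by simp) (by simp) (by simp)

section AbstractIndex

variable {k L : Type*} [Field k] [LieRing L] [LieAlgebra k L]

@[simp] lemma lieForm_apply (f : Dual k L) (x y : L) : lieForm f x y = f ⁅x, y⁆ := rfl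

/-- `L^f`. -/
def lieRad (f : Dual k L) : Submodule k L where
  carrier := {x : L | ∀ y : L, f ⁅x, y⁆ = 0}
  add_mem' := fun hx hy z => by rw [add_lie, map_add, hx z, hy z, add_zero]
  zero_mem' := fun z => by rw [zero_lie, map_zero]
  smul_mem' := fun c x hx z => by rw [smul_lie, map_smul, hx z, smul_zero]

lemma mem_lieRad {f : Dual k L} {x : L} : x ∈ lieRad f ↔ ∀ y : L, f ⁅x, y⁆ = 0 := Iff.rfl

lemma lieForm_isRefl (f : Dual k L) : (lieForm f).IsRefl := by
  intro x y h
  simp only [lieForm_apply] at *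
  rw [← lie_skew, map_neg, h, neg_zero]

lemma flip_zero {f : Dual k L} {x y : L} (h : f ⁅x, y⁆ = 0) : f ⁅y, x⁆ = 0 :=
  lieForm_isRefl f x y h

lemma orthogonal_top_eq_lieRad (f : Dual k L) : (lieForm f).orthogonal ⊤ = lieRad f := by
  ext x
  simp only [LinearMap.BilinForm.mem_orthogonal_iff,
    lieForm_apply, mem_lieRad]
  exact ⟨fun h y => flip_zero (h y trivial), fun h y _ => flip_zero (h y)⟩

lemma mem_orth {f : Dual k L} {J : Submodule k L} {x : L} :
    x ∈ (lieForm f).orthogonal J ↔ ∀ y ∈ J, f ⁅x, y⁆ = 0 := by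
  simp only [LinearMap.BilinForm.mem_orthogonal_iff,
    lieForm_apply]
  exact ⟨fun h y hy => flip_zero (h y hy), fun h y hy => flip_zero (h y hy)⟩

/-- Two linear forms which agree on the intersection of two subspaces glue. -/
lemma exists_glue (U W : Submodule k L) (f g : Dual k L) (h : ∀ x ∈ U, x ∈ W → f x = g x) :
    ∃ F : Dual k L, (∀ x ∈ U, F x = f x) ∧ ∀ x ∈ W, F x = g x := by
  -- extend `(f - g)` restricted to `U`, killing `W`
  have hk : ∀ x ∈ U, x ∈ W → (f - g) x = 0 := by
    intro x hx hw; simp [h x hx hw]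
  let φ : U →ₗ[k] L ⧸ W := W.mkQ.comp U.subtype
  have hle : LinearMap.ker φ ≤ LinearMap.ker ((f - g).comp U.subtype) := by
    intro x hx
    have : (x : L) ∈ W := by simpa [φ] using hx
    simpa using hk x x.2 this
  obtain ⟨ψ, hψ⟩ := LinearMap.exists_extend
    ((Submodule.liftQ _ ((f - g).comp U.subtype) hle).comp
      (LinearMap.quotKerEquivRange φ).symm.toLinearMap)
  refine ⟨g + ψ.comp W.mkQ, ?_, ?_⟩
  · intro x hx
    have h1 := LinearMap.congr_fun hψ (⟨φ ⟨x, hx⟩, ⟨_, rfl⟩⟩ : LinearMap.range φ)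
    have h2 : (LinearMap.quotKerEquivRange φ).symm ⟨φ ⟨x, hx⟩, ⟨_, rfl⟩⟩
        = (LinearMap.ker φ).mkQ ⟨x, hx⟩ := by
      rw [LinearEquiv.symm_apply_eq]; rfl
    simp only [LinearMap.comp_apply, Submodule.subtype_apply, LinearEquiv.coe_coe] at h1
    rw [h2] at h1
    have h3 : ψ (W.mkQ x) = (f - g) x := h1
    simp only [LinearMap.add_apply, LinearMap.comp_apply, h3, LinearMap.sub_apply]; ring
  · intro x hx
    have : W.mkQ x = 0 := by simpa using hx
    simp [this]

variable [FiniteDimensional k L]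

/-- Semicontinuity of the dimension of the stabiliser. -/
lemma exists_generic [Infinite k] (f f₀ : Dual k L) (z : L) (hz : f₀ z ≠ 0) :
    ∃ t : k, (f + t • f₀) z ≠ 0 ∧ finrank k (lieRad (f + t • f₀)) ≤ finrank k (lieRad f) := by
  obtain ⟨W, hW⟩ := (lieRad f).exists_isCompl
  let A : W →ₗ[k] Dual k L := LinearMap.comp (lieForm f : L →ₗ[k] L →ₗ[k] k) W.subtype
  let B : W →ₗ[k] Dual k L := LinearMap.comp (lieForm f₀ : L →ₗ[k] L →ₗ[k] k) W.subtype
  have hA : LinearMap.ker A = ⊥ := by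
    rw [LinearMap.ker_eq_bot']
    intro w hw
    have : (w : L) ∈ lieRad f := fun y => LinearMap.congr_fun hw y
    have := hW.disjoint.le_bot ⟨this, w.2⟩
    simpa using this
  obtain ⟨C, hC⟩ := A.exists_leftInverse_of_injective hA
  let N : End k W := C.comp B
  have hfin := Module.End.finite_hasEigenvalue (f := N)
  have hfin2 : ({t : k | N.HasEigenvalue (-t⁻¹)} ∪ {0, -(f z) / f₀ z}).Finite := by
    refine Set.Finite.union ?_ (Set.toFinite _)
    refine hfin.preimage (f := fun t : k => -t⁻¹) ?_
    intro a _ b _ h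
    simpa using h
  obtain ⟨t, ht⟩ := hfin2.exists_notMem
  simp only [Set.mem_union, Set.mem_ofPred_eq, Set.mem_insert_iff, Set.mem_singleton_iff,
    not_or] at ht
  obtain ⟨h1, h2, h3⟩ := ht
  refine ⟨t, ?_, ?_⟩
  · intro h
    apply h3
    rw [eq_div_iff hz]
    simp only [LinearMap.add_apply, LinearMap.smul_apply, smul_eq_mul] at h
    linear_combination h
  · have hdis : Disjoint (lieRad (f + t • f₀)) W := by
      rw [Submodule.disjoint_def]
      intro x hx hxW
      by_contra hne
      apply h1
      apply Module.End.hasEigenvalue_of_hasEigenvector (x := ⟨x, hxW⟩)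
      refine ⟨?_, by simpa using hne⟩
      rw [Module.End.mem_eigenspace_iff]
      have h4 : A ⟨x, hxW⟩ + t • B ⟨x, hxW⟩ = 0 := by
        ext y
        exact hx y
      have h5 := congrArg C h4
      have h6 := LinearMap.congr_fun hC ⟨x, hxW⟩
      simp only [LinearMap.comp_apply, LinearMap.id_apply] at h6
      rw [map_add, map_smul, h6, map_zero] at h5
      change C (B _) = _
      rw [neg_smul, eq_neg_iff_add_eq_zero]
      have h7 := congrArg (fun v => t⁻¹ • v) h5
      simp only [smul_add, smul_smul, inv_mul_cancel₀ h2, one_smul, smul_zero] at h7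
      rw [add_comm]; exact h7
    have h8 := Submodule.finrank_add_finrank_le_of_disjoint hdis
    have h9 := Submodule.finrank_add_eq_of_isCompl hW
    omega

/-- Reduction of the index along a pair of ideals `I ≤ J`. -/
lemma finrank_lieRad_reduce (I J : Submodule k L) (hIJ : I ≤ J)
    (hI : ∀ x ∈ I, ∀ y : L, ⁅x, y⁆ ∈ I) (hJ : ∀ x ∈ J, ∀ y : L, ⁅x, y⁆ ∈ J)
    (f f' : Dual k L) (hf : ∀ x ∈ I, f x = 0) (hf' : ∀ x ∈ J, f' x = 0)
    (hN : ∀ x ∈ J, (∀ y ∈ J, f ⁅x, y⁆ = 0) → x ∈ I)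
    (hff' : ∀ x ∈ (lieForm f).orthogonal J, f x = f' x) :
    finrank k (lieRad f') + finrank k I = finrank k (lieRad f) + finrank k J := by
  set Q := (lieForm f).orthogonal J with hQ
  have hJ' : ∀ x ∈ J, ∀ y : L, ⁅y, x⁆ ∈ J := fun x hx y => by
    rw [← lie_skew]; exact J.neg_mem (hJ x hx y)
  have hIrad : I ≤ lieRad f := fun x hx y => hf _ (hI x hx y)
  have hradQ : lieRad f ≤ Q := fun x hx => mem_orth.2 fun y _ => hx y
  have hJrad : J ⊓ lieRad f = I := by
    apply le_antisymm
    · rintro x ⟨hx, hx'⟩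
      exact hN x hx fun y _ => hx' y
    · exact le_inf hIJ hIrad
  have hJQ : J ⊓ Q = I := by
    apply le_antisymm
    · rintro x ⟨hx, hx'⟩
      exact hN x hx (mem_orth.1 hx')
    · exact le_inf hIJ (hIrad.trans hradQ)
  have h1 := LinearMap.BilinForm.finrank_add_finrank_orthogonal (lieForm_isRefl f) J
  rw [orthogonal_top_eq_lieRad, hJrad, ← hQ] at h1
  have h2 := Submodule.finrank_sup_add_finrank_inf_eq J Q
  rw [hJQ] at h2
  have htop : J ⊔ Q = ⊤ := by
    apply Submodule.eq_top_of_finrank_eq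
    omega
  have hJf' : J ≤ lieRad f' := fun x hx y => hf' _ (hJ x hx y)
  have hQQ : ∀ x ∈ Q, ∀ y ∈ Q, ⁅x, y⁆ ∈ Q := by
    intro x hx y hy
    rw [hQ, mem_orth] at *
    intro z hz
    rw [lie_lie, map_sub, hx _ (hJ' z hz y), hy _ (hJ' z hz x), sub_zero]
  have hrad : lieRad f' = J ⊔ lieRad f := by
    apply le_antisymm
    · intro x hx
      have : x ∈ J ⊔ Q := htop ▸ trivial
      obtain ⟨j, hj, q, hq, rfl⟩ := Submodule.mem_sup.1 this
      refine Submodule.add_mem_sup hj ?_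
      have hq' : q ∈ lieRad f' := by
        have := (lieRad f').sub_mem hx (hJf' hj)
        simpa using this
      intro y
      have : y ∈ J ⊔ Q := htop ▸ trivial
      obtain ⟨j', hj', q', hq'', rfl⟩ := Submodule.mem_sup.1 this
      rw [lie_add, map_add, mem_orth.1 hq _ hj', hff' _ (hQQ _ hq _ hq''), hq' q', add_zero]
    · refine sup_le hJf' ?_
      intro x hx y
      have : y ∈ J ⊔ Q := htop ▸ trivial
      obtain ⟨j', hj', q', hq'', rfl⟩ := Submodule.mem_sup.1 this
      rw [lie_add, map_add, hf' _ (hJ' _ hj' _), ← hff' _ (hQQ _ (hradQ hx) _ hq''), hx q',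
        add_zero]
  have h3 := Submodule.finrank_sup_add_finrank_inf_eq J (lieRad f)
  rw [hJrad, ← hrad] at h3
  omega

/-- The index statement for the quotient by `I`, phrased inside `L`. -/
def IndexMod (I : Submodule k L) (m : ℕ) : Prop :=
  (∃ f : Dual k L, (∀ x ∈ I, f x = 0) ∧ finrank k (lieRad f) = m + finrank k I) ∧
  ∀ f : Dual k L, (∀ x ∈ I, f x = 0) → m + finrank k I ≤ finrank k (lieRad f)

theorem indexMod_reduce [Infinite k] (I J : Submodule k L) (hIJ : I ≤ J)
    (hI : ∀ x ∈ I, ∀ y : L, ⁅x, y⁆ ∈ I) (hJ : ∀ x ∈ J, ∀ y : L, ⁅x, y⁆ ∈ J)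
    (z : L) (hz : z ∉ I)
    (hN : ∀ f : Dual k L, (∀ x ∈ I, f x = 0) → f z ≠ 0 →
      ∀ x ∈ J, (∀ y ∈ J, f ⁅x, y⁆ = 0) → x ∈ I)
    (m : ℕ) (h : IndexMod J m) : IndexMod I m := by
  obtain ⟨f₀, hf₀z, hf₀⟩ := Submodule.exists_le_ker_of_notMem hz
  obtain ⟨⟨f', hf', hdim⟩, hmin⟩ := h
  have hf₀I : ∀ x ∈ I, f₀ x = 0 := fun x hx => by
    have := hf₀ hx
    simpa using this
  have horth : ∀ f g : Dual k L, (∀ x ∈ J, f x = g x) →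
      (lieForm f).orthogonal J = (lieForm g).orthogonal J := by
    intro f g hfg
    ext x
    rw [mem_orth, mem_orth]
    refine forall₂_congr fun y hy => ?_
    rw [hfg]
    rw [← lie_skew]; exact J.neg_mem (hJ y hy x)
  have hinter : ∀ f : Dual k L, (∀ x ∈ I, f x = 0) → f z ≠ 0 →
      ∀ x ∈ J, x ∈ (lieForm f).orthogonal J → x ∈ I := fun f hf hfz x hx hx' =>
    hN f hf hfz x hx (mem_orth.1 hx')
  by_cases hzJ : z ∈ J
  swap
  · -- then `f₀` may be taken to vanish on `J`, so `J ≤ I`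
    obtain ⟨g, hgz, hg⟩ := Submodule.exists_le_ker_of_notMem hzJ
    have hgJ : ∀ x ∈ J, g x = 0 := fun x hx => by
      have := hg hx
      simpa using this
    have : J = I := le_antisymm (fun x hx => hN g (fun y hy => hgJ y (hIJ hy)) hgz x hx
      fun y hy => hgJ _ (hJ x hx y)) hIJ
    subst this
    exact ⟨⟨f', hf', hdim⟩, hmin⟩
  constructor
  · obtain ⟨f, hfJ, hfQ⟩ := exists_glue J ((lieForm f₀).orthogonal J) f₀ f' (by
      intro x hx hx'
      rw [hf' x hx, hf₀I x (hinter f₀ hf₀I hf₀z x hx hx')])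
    have hfI : ∀ x ∈ I, f x = 0 := fun x hx => by rw [hfJ x (hIJ hx), hf₀I x hx]
    have hfz : f z ≠ 0 := by rw [hfJ z hzJ]; exact hf₀z
    refine ⟨f, hfI, ?_⟩
    have := finrank_lieRad_reduce I J hIJ hI hJ f f' hfI hf' (hN f hfI hfz) (by
      rw [horth f f₀ hfJ]; exact hfQ)
    omega
  · intro f hf
    obtain ⟨t, ht, hle⟩ := exists_generic f f₀ z hf₀z
    refine le_trans ?_ hle
    set F := f + t • f₀
    have hF : ∀ x ∈ I, F x = 0 := fun x hx => by simp [F, hf x hx, hf₀I x hx]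
    obtain ⟨F', hFJ, hFQ⟩ := exists_glue J ((lieForm F).orthogonal J) 0 F (by
      intro x hx hx'
      rw [hF x (hinter F hF ht x hx hx')]; rfl)
    have := finrank_lieRad_reduce I J hIJ hI hJ F F' hF hFJ (hN F hF ht) (fun x hx => (hFQ x hx).symm)
    have := hmin F' hFJ
    omega

end AbstractIndex

namespace RootSystemData

/-- The submonoid `ℕS`. -/
abbrev natSpan {V : Type*} [AddCommGroup V] (S : Finset V) : AddSubmonoid V :=
  AddSubmonoid.closure (S : Set V)

section Combinatorics

variable {k V : Type*} [Field k] [CharZero k] [AddCommGroup V] [Module k V]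

/-- The facts on root systems which are imported from the general theory. -/
structure Good (P : RootSystemData k V) (Δ : Finset V) : Prop where
  base : P.IsBase Δ
  sub_mem : ∀ α ∈ P.roots, ∀ β ∈ P.roots, 0 < P.pairInt α β → α ≠ β → α - β ∈ P.roots
  pos_symm : ∀ α ∈ P.roots, ∀ β ∈ P.roots, 0 < P.pairInt α β → 0 < P.pairInt β α
  zero_symm : ∀ α ∈ P.roots, ∀ β ∈ P.roots, P.pairInt α β = 0 → P.pairInt β α = 0

variable {P : RootSystemData k V} {Δ : Finset V}

lemma natSpan_mono {S T : Finset V} (h : S ⊆ T) : natSpan S ≤ natSpan T :=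
  AddSubmonoid.closure_mono (by exact_mod_cast h)

lemma mem_natSpan_self {S : Finset V} {a : V} (h : a ∈ S) : a ∈ natSpan S :=
  AddSubmonoid.subset_closure h

lemma exists_natCoord {S : Finset V} (hS : S ⊆ Δ) {x : V} (hx : x ∈ natSpan S) :
    ∃ m : V → ℕ, (∀ a, a ∉ S → m a = 0) ∧ x = ∑ a ∈ Δ, m a • a := by
  obtain ⟨m, hm, rfl⟩ := AddSubmonoid.mem_closure_finset.1 hx
  have h0 : ∀ a, a ∉ S → m a = 0 := fun a ha => by
    by_contra h
    exact ha (hm h)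
  refine ⟨m, h0, ?_⟩
  exact Finset.sum_subset hS fun a _ ha => by rw [h0 a ha, zero_smul]

lemma natCoord_mem {S : Finset V} (m : V → ℕ) (hm : ∀ a ∈ Δ, a ∉ S → m a = 0) :
    ∑ a ∈ Δ, m a • a ∈ natSpan S := by
  refine AddSubmonoid.sum_mem _ fun a ha => ?_
  by_cases h : a ∈ S
  · exact AddSubmonoid.nsmul_mem _ (mem_natSpan_self h) _
  · rw [hm a ha h, zero_smul]; exact AddSubmonoid.zero_mem _

lemma exists_intCoord {S : Finset V} (hS : S ⊆ Δ) {x : V}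
    (hx : x ∈ AddSubgroup.closure (S : Set V)) :
    ∃ m : V → ℤ, (∀ a, a ∉ S → m a = 0) ∧ x = ∑ a ∈ Δ, m a • a := by
  induction hx using AddSubgroup.closure_induction with
  | mem x hx =>
    have hx : x ∈ S := hx
    refine ⟨fun a => if a = x then 1 else 0, fun a ha => ?_, ?_⟩
    · exact if_neg (by rintro rfl; exact ha hx)
    · simp [ite_smul, hS hx]
  | zero => exact ⟨0, by simp, by simp⟩
  | add x y _ _ hx hy =>
    obtain ⟨m, hm, rfl⟩ := hx
    obtain ⟨n, hn, rfl⟩ := hy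
    exact ⟨m + n, fun a ha => by simp [hm a ha, hn a ha], by
      simp [add_smul, Finset.sum_add_distrib]⟩
  | neg x _ hx =>
    obtain ⟨m, hm, rfl⟩ := hx
    exact ⟨-m, fun a ha => by simp [hm a ha], by simp⟩

lemma natSpan_le_intSpan {S : Finset V} {x : V} (hx : x ∈ natSpan S) :
    x ∈ AddSubgroup.closure (S : Set V) := by
  induction hx using AddSubmonoid.closure_induction with
  | mem x hx => exact AddSubgroup.subset_closure hx
  | zero => exact AddSubgroup.zero_mem _
  | add x y _ _ hx hy => exact AddSubgroup.add_mem _ hx hy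

namespace Good

lemma coord_zero (G : P.Good Δ) (z : V → ℤ) (h : ∑ a ∈ Δ, z a • a = 0) : ∀ a ∈ Δ, z a = 0 := by
  have hi : LinearIndepOn k id (Δ : Set V) := G.base.indep
  rw [linearIndepOn_finset_iff] at hi
  intro a ha
  have := hi (fun a => (z a : k)) (by simpa [Int.cast_smul_eq_zsmul] using h) a ha
  exact_mod_cast this

lemma coord_unique (G : P.Good Δ) (z w : V → ℤ) (h : ∑ a ∈ Δ, z a • a = ∑ a ∈ Δ, w a • a) :
    ∀ a ∈ Δ, z a = w a := by
  intro a ha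
  have := G.coord_zero (fun a => z a - w a) (by simp [sub_smul, h]) a ha
  simpa [sub_eq_zero] using this

lemma nat_sum_eq (m : V → ℕ) : ∑ a ∈ Δ, m a • a = ∑ a ∈ Δ, (m a : ℤ) • a := by simp

lemma pointed (G : P.Good Δ) {x : V} (hx : x ∈ natSpan Δ) (hx' : -x ∈ natSpan Δ) : x = 0 := by
  obtain ⟨m, -, hm⟩ := exists_natCoord (Δ := Δ) subset_rfl hx
  obtain ⟨n, -, hn⟩ := exists_natCoord (Δ := Δ) subset_rfl hx'
  have h0 := G.coord_zero (fun a => (m a : ℤ) + n a) (by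
    simp only [add_smul, Finset.sum_add_distrib, natCast_zsmul, ← hm, ← hn]; simp)
  rw [hm]
  refine Finset.sum_eq_zero fun a ha => ?_
  have := h0 a ha
  have : m a = 0 := by omega
  rw [this, zero_smul]

lemma mem_of_add_mem (G : P.Good Δ) {S : Finset V} (hS : S ⊆ Δ) {x y : V} (hx : x ∈ natSpan Δ)
    (hy : y ∈ natSpan Δ) (hxy : x + y ∈ natSpan S) : x ∈ natSpan S := by
  obtain ⟨m, -, hm⟩ := exists_natCoord (Δ := Δ) subset_rfl hx
  obtain ⟨n, -, hn⟩ := exists_natCoord (Δ := Δ) subset_rfl hy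
  obtain ⟨l, hl, hl'⟩ := exists_natCoord hS hxy
  rw [hm]
  refine natCoord_mem m fun a ha haS => ?_
  have := G.coord_unique (fun a => (m a : ℤ) + n a) (fun a => (l a : ℤ)) (by
    simp only [add_smul, Finset.sum_add_distrib, natCast_zsmul, ← hm, ← hn, ← hl']) a ha
  simp only [hl a haS] at this
  omega

lemma pos_or_neg_of (G : P.Good Δ) {S : Finset V} (hS : S ⊆ Δ) {x : V} (hx : x ∈ P.roots)
    (hxS : x ∈ AddSubgroup.closure (S : Set V)) : x ∈ natSpan S ∨ -x ∈ natSpan S := by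
  obtain ⟨z, hz, hz'⟩ := exists_intCoord hS hxS
  rcases G.base.pos_or_neg x hx with h | h
  · left
    obtain ⟨m, -, hm⟩ := exists_natCoord (Δ := Δ) subset_rfl h
    have hu := G.coord_unique (fun a => (m a : ℤ)) z (by rw [← nat_sum_eq, ← hm, hz'])
    rw [hm]
    refine natCoord_mem m fun a ha haS => ?_
    have := hu a ha
    rw [hz a haS] at this
    exact_mod_cast this
  · right
    obtain ⟨m, -, hm⟩ := exists_natCoord (Δ := Δ) subset_rfl h
    have hu := G.coord_unique (fun a => (m a : ℤ)) (fun a => - z a) (by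
      rw [← nat_sum_eq, ← hm, hz']; simp)
    rw [hm]
    refine natCoord_mem m fun a ha haS => ?_
    have := hu a ha
    rw [hz a haS] at this
    omega

lemma neg_mem (G : P.Good Δ) {α : V} (h : α ∈ P.roots) : -α ∈ P.roots := by
  have := P.reflect_mem α h α h
  rw [P.pair_self α h, two_smul] at this
  simpa using this

lemma pair_sum (G : P.Good Δ) {α β : V} (hα : α ∈ P.roots) (hβ : β ∈ P.roots) (z : V → ℤ)
    (h : β = ∑ a ∈ Δ, z a • a) : P.pairInt β α = ∑ a ∈ Δ, z a * P.pairInt a α := by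
  have h1 := P.pair_compat α hα β hβ
  have : ((P.pairInt β α : ℤ) : k) = ((∑ a ∈ Δ, z a * P.pairInt a α : ℤ) : k) := by
    rw [h1, h, map_sum]
    push_cast
    refine Finset.sum_congr rfl fun a ha => ?_
    rw [map_zsmul, ← P.pair_compat α hα a (G.base.subset ha), zsmul_eq_mul]
  exact_mod_cast this

lemma pair_sum_nat (G : P.Good Δ) {α β : V} (hα : α ∈ P.roots) (hβ : β ∈ P.roots) (z : V → ℕ)
    (h : β = ∑ a ∈ Δ, z a • a) : P.pairInt β α = ∑ a ∈ Δ, (z a : ℤ) * P.pairInt a α :=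
  G.pair_sum hα hβ (fun a => (z a : ℤ)) (by rw [h, nat_sum_eq])

lemma pair_neg (G : P.Good Δ) {α β : V} (hα : α ∈ P.roots) (hβ : β ∈ P.roots) :
    P.pairInt (-β) α = - P.pairInt β α := by
  have : ((P.pairInt (-β) α : ℤ) : k) = ((- P.pairInt β α : ℤ) : k) := by
    rw [P.pair_compat α hα _ (G.neg_mem hβ), map_neg]
    push_cast
    rw [P.pair_compat α hα _ hβ]
  exact_mod_cast this

lemma pair_add (G : P.Good Δ) {α β γ : V} (hα : α ∈ P.roots) (hβ : β ∈ P.roots)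
    (hγ : γ ∈ P.roots) (h : β + γ ∈ P.roots) :
    P.pairInt (β + γ) α = P.pairInt β α + P.pairInt γ α := by
  have : ((P.pairInt (β + γ) α : ℤ) : k) = ((P.pairInt β α + P.pairInt γ α : ℤ) : k) := by
    rw [P.pair_compat α hα _ h, map_add]
    push_cast
    rw [P.pair_compat α hα _ hβ, P.pair_compat α hα _ hγ]
  exact_mod_cast this

lemma pair_sub (G : P.Good Δ) {α β γ : V} (hα : α ∈ P.roots) (hβ : β ∈ P.roots)
    (hγ : γ ∈ P.roots) (h : β - γ ∈ P.roots) :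
    P.pairInt (β - γ) α = P.pairInt β α - P.pairInt γ α := by
  rw [sub_eq_add_neg] at h ⊢
  rw [G.pair_add hα hβ (G.neg_mem hγ) h, G.pair_neg hα hγ, sub_eq_add_neg]

lemma add_mem (G : P.Good Δ) {α β : V} (hα : α ∈ P.roots) (hβ : β ∈ P.roots)
    (h : P.pairInt α β < 0) (hne : α + β ≠ 0) : α + β ∈ P.roots := by
  have h1 := G.sub_mem (-α) (G.neg_mem hα) β hβ (by rw [G.pair_neg hβ hα]; omega)
    (fun h => hne (by rw [← h]; simp))
  have := G.neg_mem h1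
  rwa [neg_sub, sub_neg_eq_add, add_comm] at this

lemma simple_nonpos (G : P.Good Δ) {a b : V} (ha : a ∈ Δ) (hb : b ∈ Δ) (hab : a ≠ b) :
    P.pairInt a b ≤ 0 := by
  by_contra hpos
  push Not at hpos
  have hm := G.sub_mem a (G.base.subset ha) b (G.base.subset hb) hpos hab
  have key : ∀ a ∈ Δ, ∀ b ∈ Δ, a ≠ b → a - b ∉ natSpan Δ := by
    intro a ha b hb hab h
    have := G.mem_of_add_mem (S := {a}) (by simpa using ha) (mem_natSpan_self hb) h
      (by rw [add_sub_cancel]; exact mem_natSpan_self (by simp))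
    obtain ⟨m, hm, hm'⟩ := exists_natCoord (Δ := Δ) (by simpa using ha) this
    have h2 := G.coord_unique (fun c => if c = b then 1 else 0) (fun c => (m c : ℤ)) (by
      rw [← nat_sum_eq, ← hm']; simp [ite_smul, hb]) b hb
    simp [hm b (by simpa using hab.symm)] at h2
  rcases G.base.pos_or_neg _ hm with h | h
  · exact key a ha b hb hab h
  · rw [neg_sub] at h
    exact key b hb a ha hab.symm h

/-- A root which is maximal among the roots of `R^C`. -/
def Maxl (P : RootSystemData k V) (C : Finset V) (β : V) : Prop :=
  β ∈ P.roots ∧ β ∈ natSpan C ∧ ∀ γ ∈ P.roots, γ - β ∈ natSpan C → γ = β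

lemma exists_maxl (G : P.Good Δ) {C : Finset V} (hC : C ⊆ Δ) {β : V} (hβ : β ∈ P.roots)
    (hβC : β ∈ natSpan C) : ∃ θ, Maxl P C θ ∧ θ - β ∈ natSpan C := by
  induction hn : (P.roots.filter fun γ => γ - β ∈ natSpan C).card using Nat.strong_induction_on
    generalizing β with
  | _ n ih =>
  by_cases hmax : ∀ γ ∈ P.roots, γ - β ∈ natSpan C → γ = β
  · exact ⟨β, ⟨hβ, hβC, hmax⟩, by simp⟩
  · push Not at hmax
    obtain ⟨γ, hγ, hγβ, hne⟩ := hmax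
    have hlt : (P.roots.filter fun δ => δ - γ ∈ natSpan C).card < n := by
      rw [← hn]
      apply Finset.card_lt_card
      refine ⟨?_, ?_⟩
      · intro δ hδ
        simp only [Finset.mem_filter] at hδ ⊢
        refine ⟨hδ.1, ?_⟩
        have := AddSubmonoid.add_mem _ hδ.2 hγβ
        simpa using this
      · intro hsub
        have : β ∈ P.roots.filter fun δ => δ - γ ∈ natSpan C :=
          hsub (by simp [hβ])
        simp only [Finset.mem_filter] at this
        apply hne
        rw [← sub_eq_zero]
        exact G.pointed (natSpan_mono hC hγβ) (by rw [neg_sub]; exact natSpan_mono hC this.2)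
    obtain ⟨θ, hθ, hθγ⟩ := ih _ hlt hγ (by
      have := AddSubmonoid.add_mem _ hγβ hβC
      simpa using this) rfl
    refine ⟨θ, hθ, ?_⟩
    have := AddSubmonoid.add_mem _ hθγ hγβ
    simpa using this

lemma root_ne_of_mem (G : P.Good Δ) {x y : V} (hx : x ∈ P.roots) (hxΔ : x ∈ natSpan Δ)
    (hy : y ∈ natSpan Δ) : x + y ≠ 0 := by
  intro h
  have : -x = y := by rw [neg_eq_iff_add_eq_zero]; exact h
  exact P.ne_zero x hx (G.pointed hxΔ (this ▸ hy))

lemma Maxl.dominant {C : Finset V} {θ : V} (hθ : Maxl P C θ) (G : P.Good Δ) (hC : C ⊆ Δ)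
    {a : V} (ha : a ∈ C) : 0 ≤ P.pairInt θ a := by
  by_contra h
  push Not at h
  have haR := G.base.subset (hC ha)
  have := hθ.2.2 _ (G.add_mem hθ.1 haR h (G.root_ne_of_mem hθ.1 (natSpan_mono hC hθ.2.1)
    (mem_natSpan_self (hC ha)))) (by simpa using mem_natSpan_self ha)
  exact P.ne_zero a haR (by simpa using this)

lemma nonneg_symm (G : P.Good Δ) {α β : V} (hα : α ∈ P.roots) (hβ : β ∈ P.roots)
    (h : 0 ≤ P.pairInt α β) : 0 ≤ P.pairInt β α := by
  rcases h.lt_or_eq with h | h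
  · exact (G.pos_symm α hα β hβ h).le
  · exact (G.zero_symm α hα β hβ h.symm).ge

lemma linked_cross {C T : Finset V} {a b : V} (h : P.Linked C a b) (ha : a ∈ T) (hb : b ∉ T) :
    ∃ t ∈ T, ∃ c ∈ C, c ∉ T ∧ P.pairInt t c ≠ 0 := by
  induction h with
  | refl => exact absurd ha hb
  | @tail b c _ hbc ih =>
    by_cases hbT : b ∈ T
    · exact ⟨b, hbT, c, hbc.2.1, hb, hbc.2.2⟩
    · exact ih hbT

lemma Maxl.full {C : Finset V} {θ : V} (hθ : Maxl P C θ) (G : P.Good Δ) (hC : C ⊆ Δ)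
    (hconn : P.IsConnected C) (m : V → ℕ) (hm : ∀ a, a ∉ C → m a = 0)
    (hθm : θ = ∑ a ∈ Δ, m a • a) : ∀ a ∈ C, 0 < m a := by
  by_contra hcon
  push Not at hcon
  obtain ⟨c₀, hc₀, hmc₀⟩ := hcon
  obtain ⟨t₀, ht₀, hmt₀⟩ : ∃ t ∈ Δ, m t ≠ 0 := by
    by_contra h
    push Not at h
    apply P.ne_zero θ hθ.1
    rw [hθm]
    exact Finset.sum_eq_zero fun a ha => by rw [h a ha, zero_smul]
  have ht₀C : t₀ ∈ C := by
    by_contra h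
    exact hmt₀ (hm _ h)
  obtain ⟨t, ht, c, hc, hcT, hne⟩ := linked_cross (T := C.filter fun a => m a ≠ 0)
    (hconn.2 t₀ ht₀C c₀ hc₀) (by simp [ht₀C, hmt₀]) (by simp; intro _; omega)
  simp only [Finset.mem_filter] at ht hcT
  have hmc : m c = 0 := by
    by_contra h
    exact hcT ⟨hc, h⟩
  have hcR := G.base.subset (hC hc)
  have hdom := hθ.dominant G hC hc
  rw [G.pair_sum_nat hcR hθ.1 m hθm] at hdom
  have hneg : ∀ a ∈ Δ, (m a : ℤ) * P.pairInt a c ≤ 0 := by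
    intro a ha
    by_cases hac : a = c
    · rw [hac, hmc]; simp
    · exact mul_nonpos_of_nonneg_of_nonpos (by positivity) (G.simple_nonpos ha (hC hc) hac)
  have htc : t ≠ c := by
    rintro rfl
    exact ht.2 hmc
  have hlt : (m t : ℤ) * P.pairInt t c < 0 := by
    have h1 := G.simple_nonpos (hC ht.1) (hC hc) htc
    have h2 : 0 < (m t : ℤ) := by have := ht.2; omega
    exact mul_neg_of_pos_of_neg h2 (lt_of_le_of_ne h1 hne)
  have := Finset.sum_lt_sum (f := fun a => (m a : ℤ) * P.pairInt a c) (g := fun _ => (0 : ℤ))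
    hneg ⟨t, hC ht.1, hlt⟩
  simp only [Finset.sum_const_zero] at this
  omega

/-- A positive root pairs positively with some simple root in its support. -/
lemma exists_pos_pair (G : P.Good Δ) {α : V} (hα : α ∈ P.roots) (m : V → ℕ)
    (hm : α = ∑ a ∈ Δ, m a • a) : ∃ a ∈ Δ, 0 < m a ∧ 0 < P.pairInt a α := by
  by_contra h
  push Not at h
  have h2 := P.pair_self α hα
  rw [G.pair_sum_nat hα hα m hm] at h2
  have : ∑ a ∈ Δ, (m a : ℤ) * P.pairInt a α ≤ 0 := by
    refine Finset.sum_nonpos fun a ha => ?_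
    by_cases h0 : m a = 0
    · simp [h0]
    · exact mul_nonpos_of_nonneg_of_nonpos (by positivity) (h a ha (by omega))
  omega

lemma Maxl.unique {C : Finset V} {θ β : V} (hθ : Maxl P C θ) (hβ : Maxl P C β) (G : P.Good Δ)
    (hC : C ⊆ Δ) (hconn : P.IsConnected C) : θ = β := by
  obtain ⟨m, hm, hθm⟩ := exists_natCoord hC hθ.2.1
  obtain ⟨n, hn, hβn⟩ := exists_natCoord hC hβ.2.1
  obtain ⟨a, ha, hna, hpa⟩ := G.exists_pos_pair hβ.1 n hβn
  have haC : a ∈ C := by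
    by_contra h
    rw [hn a h] at hna
    omega
  have hpos : 0 < P.pairInt θ β := by
    rw [G.pair_sum_nat hβ.1 hθ.1 m hθm]
    refine Finset.sum_pos' (fun c hc => ?_) ⟨a, ha, ?_⟩
    · by_cases hcC : c ∈ C
      · exact mul_nonneg (by positivity)
          (G.nonneg_symm hβ.1 (G.base.subset hc) (hβ.dominant G hC hcC))
      · rw [hm c hcC]; simp
    · have := hθ.full G hC hconn m hm hθm a haC
      positivity
  by_contra hne
  have hroot := G.sub_mem θ hθ.1 β hβ.1 hpos hne
  rcases G.pos_or_neg_of hC hroot (AddSubgroup.sub_mem _ (natSpan_le_intSpan hθ.2.1)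
    (natSpan_le_intSpan hβ.2.1)) with h | h
  · exact hne (hβ.2.2 θ hθ.1 h)
  · rw [neg_sub] at h
    exact hne (hθ.2.2 β hβ.1 h).symm

theorem isHighestRoot (G : P.Good Δ) {C : Finset V} (hC : C ⊆ Δ) (hconn : P.IsConnected C) :
    P.IsHighestRoot C (P.highestRoot C) := by
  have hex : ∃ ε, P.IsHighestRoot C ε := by
    obtain ⟨c, hc⟩ := hconn.1
    obtain ⟨θ, hθ, -⟩ := G.exists_maxl hC (G.base.subset (hC hc)) (mem_natSpan_self hc)
    refine ⟨θ, by simpa [posRootsOf] using ⟨hθ.1, hθ.2.1⟩, ?_⟩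
    intro α hα
    simp only [rootsOf, Finset.mem_filter] at hα
    rcases G.pos_or_neg_of hC hα.1 hα.2 with h | h
    · obtain ⟨θ', hθ', h'⟩ := G.exists_maxl hC hα.1 h
      rw [hθ.unique hθ' G hC hconn]
      exact h'
    · rw [sub_eq_add_neg]
      exact AddSubmonoid.add_mem _ hθ.2.1 h
  rw [highestRoot, dif_pos hex]
  exact hex.choose_spec

/-- Decomposition of the positive roots along an orthogonal decomposition. -/
lemma split (G : P.Good Δ) {S C : Finset V} (hS : S ⊆ Δ) (hCS : C ⊆ S)
    (horth : ∀ a ∈ C, ∀ b ∈ S, b ∉ C → P.pairInt a b = 0) {α : V} (hα : α ∈ P.roots)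
    (hαS : α ∈ natSpan S) : α ∈ natSpan C ∨ α ∈ natSpan (S \ C) := by
  obtain ⟨m, hm, hαm⟩ := exists_natCoord hS hαS
  induction hn : ∑ a ∈ Δ, m a using Nat.strong_induction_on generalizing α m with
  | _ n ih =>
  obtain ⟨a, haΔ, hma, hpa⟩ := G.exists_pos_pair hα m hαm
  have haS : a ∈ S := by
    by_contra h
    rw [hm a h] at hma
    omega
  have haR := G.base.subset haΔ
  by_cases hαa : α = a
  · by_cases haC : a ∈ C
    · left; rw [hαa]; exact mem_natSpan_self haC
    · right; rw [hαa]; exact mem_natSpan_self (by simp [haC, haS])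
  have hpa' := G.pos_symm _ haR _ hα hpa
  have hsub := G.sub_mem α hα a haR hpa' hαa
  let m' : V → ℕ := fun b => if b = a then m a - 1 else m b
  have hmm : ∀ b, m b = m' b + if b = a then 1 else 0 := by
    intro b
    by_cases hb : b = a
    · simp only [m', hb, if_true]; omega
    · simp [m', hb]
  have hsum : α - a = ∑ b ∈ Δ, m' b • b := by
    rw [hαm, Finset.sum_congr rfl fun b _ => by rw [hmm b, add_smul], Finset.sum_add_distrib]
    simp [ite_smul, haΔ]
  have hm'0 : ∀ b, b ∉ S → m' b = 0 := by
    intro b hb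
    have := hmm b
    rw [hm b hb] at this
    omega
  have hcard : ∑ b ∈ Δ, m' b < n := by
    rw [← hn, Finset.sum_congr rfl fun b _ => hmm b, Finset.sum_add_distrib]
    simp [haΔ]
  have hIH := ih _ hcard hsub (by rw [hsum]; exact natCoord_mem m' fun b _ hb => hm'0 b hb)
    m' hm'0 hsum rfl
  -- the inductive step, symmetric in `C` and `S \ C`
  have key : ∀ X : Finset V, X ⊆ S → (∀ x ∈ X, ∀ y ∈ S, y ∉ X → P.pairInt x y = 0) →
      α - a ∈ natSpan X → α ∈ natSpan X := by
    intro X hXS hX hmem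
    by_cases haX : a ∈ X
    · have := AddSubmonoid.add_mem _ hmem (mem_natSpan_self haX)
      simpa using this
    exfalso
    obtain ⟨l, hl, hl'⟩ := exists_natCoord (hXS.trans hS) hmem
    have h0 : P.pairInt (α - a) a = 0 := by
      rw [G.pair_sum_nat haR hsub l hl']
      refine Finset.sum_eq_zero fun b hb => ?_
      by_cases hbX : b ∈ X
      · rw [hX b hbX a haS haX, mul_zero]
      · rw [hl b hbX]; simp
    have href := P.reflect_mem a haR _ hsub
    rw [h0] at href
    have h2 : P.pairInt α a = 2 := by
      rw [G.pair_sub haR hα haR hsub, P.pair_self a haR] at h0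
      omega
    have href := P.reflect_mem a haR α hα
    rw [h2, two_smul, ← sub_sub] at href
    rcases G.base.pos_or_neg _ href with h | h
    · have := G.mem_of_add_mem (hXS.trans hS) (mem_natSpan_self haΔ) h (by simpa using hmem)
      obtain ⟨l₂, hl₂, hl₂'⟩ := exists_natCoord (hXS.trans hS) this
      have := G.coord_unique (fun b => if b = a then 1 else 0) (fun b => (l₂ b : ℤ)) (by
        rw [← nat_sum_eq, ← hl₂']; simp [ite_smul, haΔ]) a haΔ
      simp [hl₂ a haX] at this
    · rw [neg_sub] at h
      have h3 := G.mem_of_add_mem (S := {a}) (by simpa using haΔ)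
        (natSpan_mono (hXS.trans hS) hmem) h (by
          rw [add_sub_cancel]; exact mem_natSpan_self (by simp))
      obtain ⟨l₂, hl₂, hl₂'⟩ := exists_natCoord (Δ := Δ) (by simpa using haΔ) h3
      have hu := G.coord_unique (fun b => (l b : ℤ)) (fun b => (l₂ b : ℤ)) (by
        rw [← nat_sum_eq, ← nat_sum_eq, ← hl₂', ← hl'])
      apply P.ne_zero _ hsub
      rw [hl']
      refine Finset.sum_eq_zero fun b hb => ?_
      by_cases hba : b = a
      · rw [hba, hl a haX, zero_smul]
      · have h5 : (l b : ℤ) = l₂ b := hu b hb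
        rw [hl₂ b (by simpa using hba)] at h5
        rw [show l b = 0 by exact_mod_cast h5, zero_smul]
  rcases hIH with h | h
  · exact Or.inl (key C hCS horth h)
  · refine Or.inr (key (S \ C) Finset.sdiff_subset ?_ h)
    intro x hx y hy hyX
    simp only [Finset.mem_sdiff, not_and, not_not] at hx hyX
    exact G.zero_symm y (G.base.subset (hS hy)) x (G.base.subset (hS hx.1))
      (horth y (hyX hy) x hx.1 hx.2)

end Good

end Combinatorics

end RootSystemData

namespace RootSystemData

section Combinatorics2

variable {k V : Type*} [Field k] [CharZero k] [AddCommGroup V] [Module k V]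
variable {P : RootSystemData k V} {Δ : Finset V}

lemma linked_mono {S T : Finset V} (h : T ⊆ S) {a b : V} (hab : P.Linked T a b) :
    P.Linked S a b :=
  Relation.ReflTransGen.mono
    (p := fun a b => a ∈ S ∧ b ∈ S ∧ P.pairInt a b ≠ 0)
    (fun _ _ hxy => ⟨h hxy.1, h hxy.2.1, hxy.2.2⟩) _ _ hab

/-- `T` is a union of connected components of `S`. -/
def Closed (P : RootSystemData k V) (S T : Finset V) : Prop :=
  T ⊆ S ∧ ∀ x ∈ T, ∀ y ∈ S, y ∉ T → P.pairInt x y = 0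

lemma Closed.linked {S T : Finset V} (h : Closed P S T) {a b : V} (ha : a ∈ T)
    (hab : P.Linked S a b) : b ∈ T ∧ P.Linked T a b := by
  induction hab with
  | refl => exact ⟨ha, Relation.ReflTransGen.refl⟩
  | @tail b c _ hbc ih =>
    have hc : c ∈ T := by
      by_contra hc
      exact hbc.2.2 (h.2 b ih.1 c hbc.2.1 hc)
    exact ⟨hc, ih.2.tail ⟨ih.1, hc, hbc.2.2⟩⟩

lemma Closed.component_eq {S T : Finset V} (h : Closed P S T) {a : V} (ha : a ∈ T) :
    P.component S a = P.component T a := by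
  ext b
  simp only [component, Finset.mem_filter]
  constructor
  · rintro ⟨_, hb⟩
    exact h.linked ha hb
  · rintro ⟨hb, hab⟩
    exact ⟨h.1 hb, linked_mono h.1 hab⟩

lemma component_subset (S : Finset V) (a : V) : P.component S a ⊆ S := Finset.filter_subset _ _

lemma mem_component_self {S : Finset V} {a : V} (ha : a ∈ S) : a ∈ P.component S a := by
  exact Finset.mem_filter.2 ⟨ha, Relation.ReflTransGen.refl⟩

lemma closed_component (S : Finset V) (a : V) : Closed P S (P.component S a) := by
  refine ⟨component_subset S a, fun x hx y hy hyC => ?_⟩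
  by_contra hne
  simp only [component, Finset.mem_filter] at hx hyC
  exact hyC ⟨hy, hx.2.tail ⟨hx.1, hy, hne⟩⟩

namespace Good

lemma closed_sdiff (G : P.Good Δ) {S T : Finset V} (hS : S ⊆ Δ) (h : Closed P S T) :
    Closed P S (S \ T) := by
  refine ⟨Finset.sdiff_subset, fun x hx y hy hyT => ?_⟩
  simp only [Finset.mem_sdiff, not_and, not_not] at hx hyT
  exact G.zero_symm y (G.base.subset (hS hy)) x (G.base.subset (hS hx.1))
    (h.2 y (hyT hy) x hx.1 hx.2)

lemma linked_symm (G : P.Good Δ) {S : Finset V} (hS : S ⊆ Δ) {a b : V} (h : P.Linked S a b) :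
    P.Linked S b a := by
  induction h with
  | refl => exact Relation.ReflTransGen.refl
  | @tail b c _ hbc ih =>
    refine Relation.ReflTransGen.head ⟨hbc.2.1, hbc.1, fun h0 => hbc.2.2 ?_⟩ ih
    exact G.zero_symm c (G.base.subset (hS hbc.2.1)) b (G.base.subset (hS hbc.1)) h0

lemma connected_component (G : P.Good Δ) {S : Finset V} (hS : S ⊆ Δ) {a : V} (ha : a ∈ S) :
    P.IsConnected (P.component S a) := by
  have hl : ∀ x ∈ P.component S a, P.Linked (P.component S a) a x := fun x hx =>
    ((closed_component S a).linked (mem_component_self ha) (Finset.mem_filter.1 hx).2).2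
  refine ⟨⟨a, mem_component_self ha⟩, fun x hx y hy => ?_⟩
  exact (G.linked_symm ((component_subset S a).trans hS) (hl x hx)).trans (hl y hy)

lemma components_connected {C : Finset V} (hC : P.IsConnected C) : P.components C = {C} := by
  have h : ∀ a ∈ C, P.component C a = C := fun a ha => by
    rw [component, Finset.filter_true_of_mem]
    exact fun b hb => hC.2 a ha b hb
  rw [components, Finset.image_congr (g := fun _ => C) (fun a ha => h a ha)]
  exact Finset.image_const hC.1 C

lemma components_union (G : P.Good Δ) {S T : Finset V} (hS : S ⊆ Δ) (h : Closed P S T) :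
    P.components S = P.components T ∪ P.components (S \ T) := by
  have h1 : P.components T = T.image fun a => P.component S a :=
    Finset.image_congr fun a ha => (h.component_eq ha).symm
  have h2 : P.components (S \ T) = (S \ T).image fun a => P.component S a :=
    Finset.image_congr fun a ha => ((G.closed_sdiff hS h).component_eq ha).symm
  rw [h1, h2, ← Finset.image_union, Finset.union_sdiff_of_subset h.1, components]

section Connected

variable {C : Finset V}

lemma highest_mem (G : P.Good Δ) (hC : C ⊆ Δ) (hconn : P.IsConnected C) :
    P.highestRoot C ∈ P.roots ∧ P.highestRoot C ∈ natSpan C :=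
  Finset.mem_filter.1 (G.isHighestRoot hC hconn).1

lemma le_highest (G : P.Good Δ) (hC : C ⊆ Δ) (hconn : P.IsConnected C) {α : V}
    (hα : α ∈ P.roots) (hαC : α ∈ AddSubgroup.closure (C : Set V)) :
    P.highestRoot C - α ∈ natSpan C :=
  (G.isHighestRoot hC hconn).2 α (Finset.mem_filter.2 ⟨hα, hαC⟩)

lemma highest_dominant (G : P.Good Δ) (hC : C ⊆ Δ) (hconn : P.IsConnected C) {c : V}
    (hc : c ∈ C) : 0 ≤ P.pairInt c (P.highestRoot C) := by
  obtain ⟨hε, hεC⟩ := G.highest_mem hC hconn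
  have hcR := G.base.subset (hC hc)
  apply G.nonneg_symm hε hcR
  by_contra h
  push Not at h
  have h1 := G.add_mem hε hcR h (G.root_ne_of_mem hε (natSpan_mono hC hεC)
    (mem_natSpan_self (hC hc)))
  have h2 := G.le_highest hC hconn h1 (AddSubgroup.add_mem _ (natSpan_le_intSpan hεC)
    (natSpan_le_intSpan (mem_natSpan_self hc)))
  rw [sub_add_cancel_left] at h2
  exact P.ne_zero c hcR (G.pointed (mem_natSpan_self (hC hc)) (natSpan_mono hC h2))

lemma highest_pair_nonneg (G : P.Good Δ) (hC : C ⊆ Δ) (hconn : P.IsConnected C) {α : V}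
    (hα : α ∈ P.roots) (hαC : α ∈ natSpan C) : 0 ≤ P.pairInt α (P.highestRoot C) := by
  obtain ⟨m, hm, hαm⟩ := exists_natCoord hC hαC
  rw [G.pair_sum_nat (G.highest_mem hC hconn).1 hα m hαm]
  refine Finset.sum_nonneg fun c _ => ?_
  by_cases hcC : c ∈ C
  · exact mul_nonneg (by positivity) (G.highest_dominant hC hconn hcC)
  · simp [hm c hcC]

lemma mem_zeroPart_of (G : P.Good Δ) (hC : C ⊆ Δ) (hconn : P.IsConnected C) {α : V}
    (hα : α ∈ P.roots) (hαC : α ∈ natSpan C) (h0 : P.pairInt α (P.highestRoot C) = 0) :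
    α ∈ natSpan (P.zeroPart C) := by
  obtain ⟨m, hm, hαm⟩ := exists_natCoord hC hαC
  rw [G.pair_sum_nat (G.highest_mem hC hconn).1 hα m hαm,
    Finset.sum_eq_zero_iff_of_nonneg] at h0
  · rw [hαm]
    refine natCoord_mem m fun c hc hcZ => ?_
    by_cases hcC : c ∈ C
    · have := h0 c hc
      rw [mul_eq_zero] at this
      rcases this with h | h
      · exact_mod_cast h
      · exact absurd (Finset.mem_filter.2 ⟨hcC, h⟩) hcZ
    · exact hm c hcC
  · intro c _
    by_cases hcC : c ∈ C
    · exact mul_nonneg (by positivity) (G.highest_dominant hC hconn hcC)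
    · simp [hm c hcC]

lemma pair_eq_zero_of (G : P.Good Δ) {T : Finset V} (hT : T ⊆ Δ) {ε : V} (hε : ε ∈ P.roots)
    (h : ∀ b ∈ T, P.pairInt b ε = 0) {α : V} (hα : α ∈ P.roots) (hαT : α ∈ natSpan T) :
    P.pairInt α ε = 0 := by
  obtain ⟨m, hm, hαm⟩ := exists_natCoord hT hαT
  rw [G.pair_sum_nat hε hα m hαm]
  refine Finset.sum_eq_zero fun c _ => ?_
  by_cases hcT : c ∈ T
  · rw [h c hcT, mul_zero]
  · simp [hm c hcT]

lemma zeroPart_ssubset (G : P.Good Δ) (hC : C ⊆ Δ) (hconn : P.IsConnected C) :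
    P.zeroPart C ⊂ C := by
  refine ⟨Finset.filter_subset _ _, fun h => ?_⟩
  obtain ⟨hε, hεC⟩ := G.highest_mem hC hconn
  have := G.pair_eq_zero_of hC hε (fun b hb => (Finset.mem_filter.1 (h hb)).2) hε hεC
  rw [P.pair_self _ hε] at this
  omega

end Connected

lemma of_mem_components (G : P.Good Δ) {S C : Finset V} (hS : S ⊆ Δ) (h : C ∈ P.components S) :
    C ⊆ S ∧ P.IsConnected C := by
  obtain ⟨a, ha, rfl⟩ := Finset.mem_image.1 h
  exact ⟨component_subset S a, G.connected_component hS ha⟩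

lemma components_empty : P.components ∅ = ∅ := by simp [components]

lemma aux_empty (n : ℕ) : P.cascadeAux n ∅ = ∅ := by
  cases n with
  | zero => rfl
  | succ n => simp [cascadeAux, components_empty]

lemma aux_indep (G : P.Good Δ) (n m : ℕ) (S : Finset V) (hS : S ⊆ Δ) (hn : S.card ≤ n)
    (hm : S.card ≤ m) : P.cascadeAux n S = P.cascadeAux m S := by
  induction n generalizing m S with
  | zero =>
    obtain rfl : S = ∅ := by simpa using hn
    rw [aux_empty, aux_empty]
  | succ n ih =>
    cases m with
    | zero =>
      obtain rfl : S = ∅ := by simpa using hm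
      rw [aux_empty, aux_empty]
    | succ m =>
      simp only [cascadeAux]
      refine Finset.biUnion_congr rfl fun C hC => ?_
      obtain ⟨hCS, hconn⟩ := G.of_mem_components hS hC
      have hlt := Finset.card_lt_card (G.zeroPart_ssubset (hCS.trans hS) hconn)
      have hle := Finset.card_le_card hCS
      rw [ih m (P.zeroPart C) ((Finset.filter_subset _ _).trans (hCS.trans hS)) (by omega)
        (by omega)]

lemma cascade_eq (G : P.Good Δ) {S : Finset V} (hS : S ⊆ Δ) :
    P.cascade S = (P.components S).biUnion fun C => insert C (P.cascade (P.zeroPart C)) := by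
  simp only [cascade, cascadeAux]
  refine Finset.biUnion_congr rfl fun C hC => ?_
  obtain ⟨hCS, hconn⟩ := G.of_mem_components hS hC
  have hlt := Finset.card_lt_card (G.zeroPart_ssubset (hCS.trans hS) hconn)
  have hle := Finset.card_le_card hCS
  have := G.aux_indep S.card ((P.zeroPart C).card + 1) (P.zeroPart C)
    ((Finset.filter_subset _ _).trans (hCS.trans hS)) (by omega) (by omega)
  rw [this, cascadeAux]

lemma subset_of_mem_aux (G : P.Good Δ) (n : ℕ) {S K : Finset V} (hS : S ⊆ Δ)
    (hK : K ∈ P.cascadeAux n S) : K ⊆ S := by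
  induction n generalizing S with
  | zero => simp [cascadeAux] at hK
  | succ n ih =>
    simp only [cascadeAux, Finset.mem_biUnion, Finset.mem_insert] at hK
    obtain ⟨C, hC, hK⟩ := hK
    obtain ⟨hCS, hconn⟩ := G.of_mem_components hS hC
    rcases hK with rfl | hK
    · exact hCS
    · have hZ : P.zeroPart C ⊆ C := Finset.filter_subset _ _
      exact (ih (hZ.trans (hCS.trans hS)) hK).trans (hZ.trans hCS)

/-- One step of the cascade construction. -/
theorem exists_step (G : P.Good Δ) {S : Finset V} (hS : S ⊆ Δ) (hne : S.Nonempty) :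
    ∃ (S' : Finset V) (ε : V), S' ⊂ S ∧ ε ∈ P.roots ∧ ε ∈ natSpan S ∧ ε ∉ natSpan S' ∧
      (∀ α ∈ P.roots, α ∈ natSpan S' → P.pairInt α ε = 0) ∧
      (∀ α ∈ P.roots, α ∈ natSpan S → α ∉ natSpan S' → α = ε ∨ (P.pairInt α ε = 1 ∧
        ε - α ∈ P.roots ∧ ε - α ∈ natSpan S ∧ ε - α ∉ natSpan S')) ∧
      (P.cascade S).card = (P.cascade S').card + 1 := by
  obtain ⟨a, ha⟩ := hne
  set C := P.component S a with hCdef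
  have hCS : C ⊆ S := component_subset S a
  have hCΔ := hCS.trans hS
  have hcl : Closed P S C := closed_component S a
  have hconn : P.IsConnected C := G.connected_component hS ha
  set ε := P.highestRoot C with hεdef
  obtain ⟨hε, hεC⟩ := G.highest_mem hCΔ hconn
  rw [← hεdef] at hε hεC
  set Z := P.zeroPart C with hZdef
  have hZC : Z ⊂ C := G.zeroPart_ssubset hCΔ hconn
  set S' := Z ∪ (S \ C) with hS'def
  have hS'S : S' ⊂ S := by
    refine ⟨Finset.union_subset (hZC.1.trans hCS) Finset.sdiff_subset, fun h => hZC.2 ?_⟩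
    intro c hc
    have := h (hCS hc)
    simpa [hS'def, hc] using this
  have hS'Δ := hS'S.1.trans hS
  have hz : ∀ b ∈ S', P.pairInt b ε = 0 := by
    intro b hb
    rcases Finset.mem_union.1 hb with hb | hb
    · exact (Finset.mem_filter.1 hb).2
    · rw [Finset.mem_sdiff] at hb
      have hbR := G.base.subset (hS hb.1)
      apply G.zero_symm ε hε b hbR
      exact G.pair_eq_zero_of hCΔ hbR (fun c hc => hcl.2 c hc b hb.1 hb.2) hε hεC
  have hz' : ∀ α ∈ P.roots, α ∈ natSpan S' → P.pairInt α ε = 0 := fun α hα hαS =>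
    G.pair_eq_zero_of hS'Δ hε hz hα hαS
  refine ⟨S', ε, hS'S, hε, natSpan_mono hCS hεC, ?_, hz', ?_, ?_⟩
  · intro h
    have := hz' ε hε h
    rw [P.pair_self ε hε] at this
    omega
  · intro α hα hαS hαS'
    have hαC : α ∈ natSpan C := by
      rcases G.split hS hCS hcl.2 hα hαS with h | h
      · exact h
      · exact absurd (natSpan_mono Finset.subset_union_right h) hαS'
    have hn0 := G.highest_pair_nonneg hCΔ hconn hα hαC
    have hn1 : P.pairInt α ε ≠ 0 := fun h0 =>
      hαS' (natSpan_mono Finset.subset_union_left (G.mem_zeroPart_of hCΔ hconn hα hαC h0))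
    rw [← hεdef] at hn0
    by_cases hαε : α = ε
    · exact Or.inl hαε
    right
    have h1 := G.le_highest hCΔ hconn hα (natSpan_le_intSpan hαC)
    rw [← hεdef] at h1
    have href := G.neg_mem (P.reflect_mem ε hε α hα)
    rw [neg_sub] at href
    have hn : P.pairInt α ε = 1 := by
      by_contra hne1
      have h2 := G.le_highest hCΔ hconn href (AddSubgroup.sub_mem _
        (AddSubgroup.zsmul_mem _ (natSpan_le_intSpan hεC) _) (natSpan_le_intSpan hαC))
      rw [← hεdef] at h2
      obtain ⟨n, hn⟩ : ∃ n : ℕ, P.pairInt α ε = n + 2 :=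
        ⟨(P.pairInt α ε - 2).toNat, by omega⟩
      have h3 := AddSubmonoid.add_mem _ h2 (AddSubmonoid.nsmul_mem _ hεC n)
      rw [hn] at h3
      apply hαε
      rw [eq_comm, ← sub_eq_zero]
      apply G.pointed (natSpan_mono hCΔ h1)
      convert natSpan_mono hCΔ h3 using 1
      rw [add_smul, natCast_zsmul, two_smul]
      abel
    rw [hn, one_smul] at href
    refine ⟨hn, href, natSpan_mono hCS h1, fun h => ?_⟩
    have := hz' _ href h
    rw [G.pair_sub hε hε hα href, P.pair_self ε hε, hn] at this
    omega
  · have hclZ : Closed P S' Z := by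
      refine ⟨Finset.subset_union_left, fun x hx y hy hyZ => ?_⟩
      have hy' : y ∈ S \ C := by
        rcases Finset.mem_union.1 hy with h | h
        · exact absurd h hyZ
        · exact h
      rw [Finset.mem_sdiff] at hy'
      exact hcl.2 x (hZC.1 hx) y hy'.1 hy'.2
    have hsd : S' \ Z = S \ C := by
      rw [hS'def, Finset.union_sdiff_left]
      refine Finset.sdiff_eq_self_of_disjoint ?_
      exact (Finset.sdiff_disjoint).mono_right hZC.1
    have e1 : P.cascade S = insert C (P.cascade S') := by
      rw [G.cascade_eq hS, G.cascade_eq hS'Δ, G.components_union hS hcl,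
        G.components_union hS'Δ hclZ, hsd, components_connected hconn,
        Finset.union_biUnion, Finset.union_biUnion, Finset.singleton_biUnion,
        ← G.cascade_eq (hZC.1.trans hCΔ), Finset.insert_union]
    rw [e1, Finset.card_insert_of_notMem]
    intro hmem
    have := G.subset_of_mem_aux _ hS'Δ hmem
    apply hZC.2
    intro c hc
    have := this hc
    simpa [hS'def, hc] using this

end Good

end Combinatorics2

end RootSystemData

section LieInduction

variable {k g : Type*} [Field k] [CharZero k] [LieRing g] [LieAlgebra k g]
  [FiniteDimensional k g]

/-- The facts on the root space decomposition which are imported from the general theory. -/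
structure LieGood (H : LieSubalgebra k g) (P : RootSystemData k (Dual k H))
    (W : Dual k H → Submodule k g) : Prop where
  abel : ∀ h h' : H, ⁅(h : g), (h' : g)⁆ = 0
  act : ∀ (α : Dual k H) (h : H), ∀ x ∈ W α, ⁅(h : g), x⁆ = α h • x
  lie : ∀ (α β : Dual k H), ∀ x ∈ W α, ∀ y ∈ W β, ⁅x, y⁆ ∈ W (α + β)
  zero : W 0 = H.toSubmodule
  bot : ∀ γ, γ ≠ 0 → γ ∉ P.roots → W γ = ⊥
  indep : iSupIndep W
  dim : ∀ α ∈ P.roots, ∀ x ∈ W α, ∀ y ∈ W α, x ≠ 0 → ∃ c : k, y = c • x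
  ne : ∀ α ∈ P.roots, ∃ x ∈ W α, x ≠ 0
  coroot : ∀ ε ∈ P.roots, ∃ h : H, ∀ α ∈ P.roots, α h = (P.pairInt α ε : k)
  nondeg : ∀ ε ∈ P.roots, ∀ α ∈ P.roots, ε - α ∈ P.roots → P.pairInt α ε = 1 →
    ∀ x ∈ W α, ∀ y ∈ W (ε - α), x ≠ 0 → y ≠ 0 → ⁅x, y⁆ ≠ 0

variable {H : LieSubalgebra k g} {P : RootSystemData k (Dual k H)}
  {W : Dual k H → Submodule k g} {Δ : Finset (Dual k H)}

open RootSystemData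

/-- The positive roots which are not in `ℕS`. -/
noncomputable def outRoots (P : RootSystemData k (Dual k H)) (Δ S : Finset (Dual k H)) :
    Finset (Dual k H) :=
  P.roots.filter fun α => α ∈ natSpan Δ ∧ α ∉ natSpan S

lemma mem_outRoots {S : Finset (Dual k H)} {α : Dual k H} :
    α ∈ outRoots P Δ S ↔ α ∈ P.roots ∧ α ∈ natSpan Δ ∧ α ∉ natSpan S := by
  simp [outRoots]

/-- The subspace `D ⊕ ⨁_{α ∈ R₊ \ ℕS} 𝔤^α`. -/
noncomputable def bigIdeal (P : RootSystemData k (Dual k H)) (W : Dual k H → Submodule k g)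
    (Δ S : Finset (Dual k H)) (D : Submodule k H) : Submodule k g :=
  D.map H.toSubmodule.subtype ⊔ ⨆ α ∈ outRoots P Δ S, W α

lemma mem_bigIdeal {S : Finset (Dual k H)} {D : Submodule k H} {x : g} :
    x ∈ bigIdeal P W Δ S D ↔ ∃ d ∈ D, ∃ v : Dual k H → g, (∀ α, v α ∈ W α) ∧
      x = (d : g) + ∑ α ∈ outRoots P Δ S, v α := by
  rw [bigIdeal, Submodule.mem_sup]
  constructor
  · rintro ⟨y, hy, z, hz, rfl⟩
    obtain ⟨d, hd, rfl⟩ := hy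
    rw [Submodule.mem_iSup_finset_iff_exists_sum] at hz
    obtain ⟨μ, rfl⟩ := hz
    exact ⟨d, hd, fun α => μ α, fun α => (μ α).2, rfl⟩
  · rintro ⟨d, hd, v, hv, rfl⟩
    refine ⟨d, ⟨d, hd, rfl⟩, _, ?_, rfl⟩
    rw [Submodule.mem_iSup_finset_iff_exists_sum]
    exact ⟨fun α => ⟨v α, hv α⟩, rfl⟩

lemma cartan_mem_bigIdeal {S : Finset (Dual k H)} {D : Submodule k H} {d : H} (hd : d ∈ D) :
    (d : g) ∈ bigIdeal P W Δ S D :=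
  Submodule.mem_sup_left ⟨d, hd, rfl⟩

lemma root_mem_bigIdeal {S : Finset (Dual k H)} {D : Submodule k H} {α : Dual k H}
    (hα : α ∈ outRoots P Δ S) {x : g} (hx : x ∈ W α) : x ∈ bigIdeal P W Δ S D :=
  Submodule.mem_sup_right (Submodule.mem_iSup_of_mem α (Submodule.mem_iSup_of_mem hα hx))

lemma vanish_natSpan {S : Finset (Dual k H)} {d : H} (h : ∀ a ∈ S, a d = 0) {α : Dual k H}
    (hα : α ∈ natSpan S) : α d = 0 := by
  induction hα using AddSubmonoid.closure_induction with
  | mem x hx => exact h x hx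
  | zero => simp
  | add x y _ _ hx hy => simp [hx, hy]

lemma outRoots_add (G : P.Good Δ) (LG : LieGood H P W) {S : Finset (Dual k H)} (hS : S ⊆ Δ)
    {D : Submodule k H} {α β : Dual k H} (hα : α ∈ outRoots P Δ S) (hβ : β ∈ outRoots P Δ ∅)
    {x : g} (hx : x ∈ W (α + β)) : x ∈ bigIdeal P W Δ S D := by
  rw [mem_outRoots] at hα hβ
  by_cases hr : α + β ∈ P.roots
  · refine root_mem_bigIdeal (mem_outRoots.2 ⟨hr, AddSubmonoid.add_mem _ hα.2.1 hβ.2.1, ?_⟩) hx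
    exact fun h => hα.2.2 (G.mem_of_add_mem hS hα.2.1 hβ.2.1 h)
  · rw [LG.bot _ (G.root_ne_of_mem hα.1 hα.2.1 hβ.2.1) hr, Submodule.mem_bot] at hx
    rw [hx]
    exact Submodule.zero_mem _

lemma mem_outRoots_empty {α : Dual k H} (hα : α ∈ P.roots) (hα' : α ∈ natSpan Δ) :
    α ∈ outRoots P Δ ∅ := by
  refine mem_outRoots.2 ⟨hα, hα', fun h => P.ne_zero α hα ?_⟩
  simpa [natSpan] using h

lemma bigIdeal_ideal (G : P.Good Δ) (LG : LieGood H P W) {S : Finset (Dual k H)} (hS : S ⊆ Δ)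
    {D : Submodule k H} (hD : ∀ a ∈ S, ∀ d ∈ D, a d = 0) {x y : g}
    (hx : x ∈ bigIdeal P W Δ S D) (hy : y ∈ bigIdeal P W Δ ∅ ⊤) :
    ⁅x, y⁆ ∈ bigIdeal P W Δ S D := by
  obtain ⟨d, hd, v, hv, rfl⟩ := mem_bigIdeal.1 hx
  obtain ⟨h, -, w, hw, rfl⟩ := mem_bigIdeal.1 hy
  rw [add_lie, lie_add, LG.abel, zero_add, sum_lie, lie_sum]
  refine Submodule.add_mem _ (Submodule.sum_mem _ fun β hβ => ?_)
    (Submodule.sum_mem _ fun α hα => ?_)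
  · rw [LG.act β d _ (hw β)]
    rw [mem_outRoots] at hβ
    by_cases hβS : β ∈ natSpan S
    · rw [vanish_natSpan (fun a ha => hD a ha d hd) hβS, zero_smul]
      exact Submodule.zero_mem _
    · exact Submodule.smul_mem _ _
        (root_mem_bigIdeal (mem_outRoots.2 ⟨hβ.1, hβ.2.1, hβS⟩) (hw β))
  · rw [lie_add, lie_sum]
    refine Submodule.add_mem _ ?_ (Submodule.sum_mem _ fun β hβ => ?_)
    · rw [← lie_skew, LG.act α h _ (hv α)]
      exact Submodule.neg_mem _ (Submodule.smul_mem _ _ (root_mem_bigIdeal hα (hv α)))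
    · exact outRoots_add G LG hS hα hβ (LG.lie α β _ (hv α) _ (hw β))

lemma outRoots_mono {S T : Finset (Dual k H)} (h : T ⊆ S) : outRoots P Δ S ⊆ outRoots P Δ T := by
  intro α hα
  rw [mem_outRoots] at *
  exact ⟨hα.1, hα.2.1, fun h' => hα.2.2 (natSpan_mono h h')⟩

lemma bigIdeal_mono {S T : Finset (Dual k H)} (h : T ⊆ S) {D E : Submodule k H} (hDE : D ≤ E) :
    bigIdeal P W Δ S D ≤ bigIdeal P W Δ T E :=
  sup_le_sup (Submodule.map_mono hDE) (biSup_mono fun _ hα => outRoots_mono h hα)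

lemma cartan_disjoint (LG : LieGood H P W) (S : Finset (Dual k H)) :
    Disjoint H.toSubmodule (⨆ α ∈ outRoots P Δ S, W α) := by
  rw [← LG.zero]
  refine (LG.indep 0).mono_right ?_
  refine iSup₂_le fun α hα => le_iSup₂_of_le α ?_ le_rfl
  exact P.ne_zero α (mem_outRoots.1 hα).1

lemma finrank_bigIdeal (LG : LieGood H P W) (S : Finset (Dual k H)) (D : Submodule k H) :
    finrank k (bigIdeal P W Δ S D) =
      finrank k D + finrank k (⨆ α ∈ outRoots P Δ S, W α : Submodule k g) := by
  have hle : D.map H.toSubmodule.subtype ≤ H.toSubmodule := by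
    rintro _ ⟨d, -, rfl⟩
    exact d.2
  have h := Submodule.finrank_sup_add_finrank_inf_eq (D.map H.toSubmodule.subtype)
    (⨆ α ∈ outRoots P Δ S, W α)
  rw [((cartan_disjoint LG S).mono_left hle).eq_bot, finrank_bot, add_zero,
    Submodule.finrank_map_subtype_eq] at h
  exact h

/-- The non-degeneracy input for the inductive step. -/
lemma step_nondeg (G : P.Good Δ) (LG : LieGood H P W) {S S' : Finset (Dual k H)} (hS : S ⊆ Δ)
    (hS'S : S' ⊆ S) {ε : Dual k H} (hε : ε ∈ P.roots) (hεS : ε ∈ natSpan S)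
    (hεS' : ε ∉ natSpan S')
    (hΓ : ∀ α ∈ P.roots, α ∈ natSpan S → α ∉ natSpan S' → α = ε ∨ (P.pairInt α ε = 1 ∧
        ε - α ∈ P.roots ∧ ε - α ∈ natSpan S ∧ ε - α ∉ natSpan S'))
    {D : Submodule k H} (hD : ∀ a ∈ S, ∀ d ∈ D, a d = 0) {h : H}
    (hh : ∀ α ∈ P.roots, α h = (P.pairInt α ε : k)) {z : g} (hz : z ∈ W ε)
    (F : Dual k g) (hF : ∀ x ∈ bigIdeal P W Δ S D, F x = 0) (hFz : F z ≠ 0) {x : g}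
    (hx : x ∈ bigIdeal P W Δ S' (D ⊔ k ∙ h))
    (hxy : ∀ y ∈ bigIdeal P W Δ S' (D ⊔ k ∙ h), F ⁅x, y⁆ = 0) :
    x ∈ bigIdeal P W Δ S D := by
  have hz0 : z ≠ 0 := fun h => hFz (by rw [h, map_zero])
  have hεh : ε h = 2 := by rw [hh ε hε, P.pair_self ε hε]; norm_num
  have hεout : ε ∈ outRoots P Δ S' := mem_outRoots.2 ⟨hε, natSpan_mono hS hεS, hεS'⟩
  have hpair : ∀ α ∈ P.roots, α ∈ natSpan S → α ∉ natSpan S' → 1 ≤ P.pairInt α ε := by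
    intro α hα h1 h2
    rcases hΓ α hα h1 h2 with h | h
    · rw [h, P.pair_self ε hε]; norm_num
    · rw [h.1]
  have claim : ∀ α ∈ outRoots P Δ S', ∀ β ∈ outRoots P Δ S', α + β ≠ ε → ∀ x ∈ W (α + β),
      F x = 0 := by
    intro α hα β hβ hne x hx
    rw [mem_outRoots] at hα hβ
    by_cases hr : α + β ∈ P.roots
    · by_cases hsS : α + β ∈ natSpan S
      · exfalso
        have h1 := hpair α hα.1 (G.mem_of_add_mem hS hα.2.1 hβ.2.1 hsS) hα.2.2
        have h2 := hpair β hβ.1 (G.mem_of_add_mem hS hβ.2.1 hα.2.1 (by rwa [add_comm])) hβ.2.2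
        have h3 := G.pair_add hε hα.1 hβ.1 hr
        rcases hΓ _ hr hsS (fun h => hα.2.2 (G.mem_of_add_mem (hS'S.trans hS) hα.2.1 hβ.2.1 h))
          with h | h
        · exact hne h
        · have := h.1
          omega
      · exact hF x (root_mem_bigIdeal (mem_outRoots.2
          ⟨hr, AddSubmonoid.add_mem _ hα.2.1 hβ.2.1, hsS⟩) hx)
    · rw [LG.bot _ (G.root_ne_of_mem hα.1 hα.2.1 hβ.2.1) hr, Submodule.mem_bot] at hx
      rw [hx, map_zero]
  obtain ⟨d', hd', v, hv, rfl⟩ := mem_bigIdeal.1 hx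
  obtain ⟨d, hd, e, he, rfl⟩ := Submodule.mem_sup.1 hd'
  obtain ⟨c, rfl⟩ := Submodule.mem_span_singleton.1 he
  have hDS : ∀ α ∈ natSpan S, α d = 0 := fun α hα => vanish_natSpan (fun a ha => hD a ha d hd) hα
  -- the bracket with a root vector
  have hbr : ∀ β ∈ outRoots P Δ S', β ∈ natSpan S → ∀ y ∈ W β,
      F ⁅((d + c • h : H) : g) + ∑ α ∈ outRoots P Δ S', v α, y⁆ =
        c * (P.pairInt β ε : k) * F y + ∑ α ∈ outRoots P Δ S', F ⁅v α, y⁆ := by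
    intro β hβ hβS y hy
    rw [add_lie, LG.act β _ y hy, sum_lie, map_add, map_smul, map_sum, map_add, map_smul,
      hDS β hβS, hh β (mem_outRoots.1 hβ).1]
    simp
  have hc : c = 0 := by
    have h1 := hxy z (root_mem_bigIdeal hεout hz)
    rw [hbr ε hεout hεS z hz, Finset.sum_eq_zero, add_zero, P.pair_self ε hε] at h1
    · simpa [hFz] using h1
    · intro α hα
      refine claim α hα ε hεout ?_ _ (LG.lie α ε _ (hv α) _ hz)
      simpa using P.ne_zero α (mem_outRoots.1 hα).1
  subst hc
  have hv0 : ∀ β ∈ outRoots P Δ S', β ∈ natSpan S → β ≠ ε → v β = 0 := by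
    intro β hβ hβS hne
    have hβ' := mem_outRoots.1 hβ
    obtain ⟨hp, hr, hrS, hrS'⟩ := (hΓ β hβ'.1 hβS hβ'.2.2).resolve_left hne
    obtain ⟨y, hy, hy0⟩ := LG.ne _ hr
    have hrout : ε - β ∈ outRoots P Δ S' := mem_outRoots.2 ⟨hr, natSpan_mono hS hrS, hrS'⟩
    have h1 := hxy y (root_mem_bigIdeal hrout hy)
    rw [hbr _ hrout hrS y hy, zero_mul, zero_mul, zero_add, Finset.sum_eq_single β] at h1
    · by_contra hv0
      have h2 := LG.nondeg ε hε β hβ'.1 hr hp _ (hv β) y hy hv0 hy0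
      have h3 := LG.lie β (ε - β) _ (hv β) y hy
      rw [add_sub_cancel] at h3
      obtain ⟨t, ht⟩ := LG.dim ε hε z hz _ h3 hz0
      rw [ht, map_smul, smul_eq_mul, mul_eq_zero, or_iff_left hFz] at h1
      rw [h1, zero_smul] at ht
      exact h2 ht
    · intro α hα hαβ
      refine claim α hα _ hrout ?_ _ (LG.lie α _ _ (hv α) y hy)
      intro h
      apply hαβ
      have : α = ε - (ε - β) := eq_sub_of_add_eq h
      simpa using this
    · intro h; exact absurd hβ h
  have hvε : v ε = 0 := by
    have h1 := hxy (h : g) (cartan_mem_bigIdeal (Submodule.mem_sup_right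
      (Submodule.mem_span_singleton_self h)))
    rw [add_lie, LG.abel, zero_add, sum_lie, map_sum, Finset.sum_eq_single ε] at h1
    · rw [← lie_skew, LG.act ε h _ (hv ε), map_neg, map_smul, hεh] at h1
      obtain ⟨t, ht⟩ := LG.dim ε hε z hz _ (hv ε) hz0
      rw [ht, map_smul] at h1
      have : t = 0 := by simpa [hFz] using h1
      rw [ht, this, zero_smul]
    · intro α hα hne
      by_cases hαS : α ∈ natSpan S
      · rw [hv0 α hα hαS hne, zero_lie, map_zero]
      · rw [← lie_skew, LG.act α h _ (hv α), map_neg, map_smul, hF (v α), smul_zero, neg_zero]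
        have := mem_outRoots.1 hα
        exact root_mem_bigIdeal (mem_outRoots.2 ⟨this.1, this.2.1, hαS⟩) (hv α)
    · intro h; exact absurd hεout h
  refine Submodule.add_mem _ ?_ (Submodule.sum_mem _ fun α hα => ?_)
  · rw [zero_smul, add_zero]
    exact cartan_mem_bigIdeal hd
  · by_cases hαS : α ∈ natSpan S
    · by_cases hne : α = ε
      · rw [hne, hvε]; exact Submodule.zero_mem _
      · rw [hv0 α hα hαS hne]; exact Submodule.zero_mem _
    · have := mem_outRoots.1 hα
      exact root_mem_bigIdeal (mem_outRoots.2 ⟨this.1, this.2.1, hαS⟩) (hv α)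

/-- A subspace of `𝔤`, intersected with a subalgebra `𝔟` and viewed inside `𝔟`. -/
def subIn (b : LieSubalgebra k g) (I : Submodule k g) : Submodule k b where
  carrier := {x : b | (x : g) ∈ I}
  add_mem' := fun hx hy => I.add_mem hx hy
  zero_mem' := I.zero_mem
  smul_mem' := fun c _ hx => I.smul_mem c hx

lemma mem_subIn {b : LieSubalgebra k g} {I : Submodule k g} {x : b} :
    x ∈ subIn b I ↔ (x : g) ∈ I := Iff.rfl

lemma finrank_subIn {b : LieSubalgebra k g} {I : Submodule k g} (h : I ≤ b.toSubmodule) :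
    finrank k (subIn b I) = finrank k I :=
  (Submodule.comapSubtypeEquivOfLe h).finrank_eq

theorem main_induction (G : P.Good Δ) (LG : LieGood H P W) (b : LieSubalgebra k g)
    (hb : b.toSubmodule = bigIdeal P W Δ ∅ ⊤) (S : Finset (Dual k H)) (hS : S ⊆ Δ)
    (D : Submodule k H) (hD : ∀ a ∈ S, ∀ d ∈ D, a d = 0) :
    ∃ m : ℕ, m + finrank k D + (P.cascade S).card = finrank k H ∧
      IndexMod (subIn b (bigIdeal P W Δ S D)) m := by
  have hle : ∀ (S : Finset (Dual k H)) (D : Submodule k H),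
      bigIdeal P W Δ S D ≤ b.toSubmodule := fun S D => by
    rw [hb]; exact bigIdeal_mono (Finset.empty_subset _) le_top
  have hfr : ∀ (S : Finset (Dual k H)) (D : Submodule k H),
      finrank k (subIn b (bigIdeal P W Δ S D)) =
        finrank k (bigIdeal P W Δ S D) := fun S D =>
    finrank_subIn (hle S D)
  have hmemb : ∀ y : b, (y : g) ∈ bigIdeal P W Δ ∅ ⊤ := fun y => by
    rw [← hb]; exact y.2
  have hid : ∀ (S : Finset (Dual k H)) (D : Submodule k H), S ⊆ Δ →
      (∀ a ∈ S, ∀ d ∈ D, a d = 0) →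
      ∀ x ∈ subIn b (bigIdeal P W Δ S D), ∀ y : b,
        ⁅x, y⁆ ∈ subIn b (bigIdeal P W Δ S D) := fun S D hS hD x hx y =>
    bigIdeal_ideal G LG hS hD (x := (x : g)) (y := (y : g)) hx (hmemb y)
  induction hn : S.card using Nat.strong_induction_on generalizing S D with
  | _ n ih =>
  by_cases hne : S.Nonempty
  · obtain ⟨S', ε, hS'S, hε, hεS, hεS', hz0, hΓ, hcard⟩ := G.exists_step hS hne
    obtain ⟨h, hh⟩ := LG.coroot ε hε
    have hεh : ε h = 2 := by rw [hh ε hε, P.pair_self ε hε]; norm_num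
    have hhD : h ∉ D := fun hmem => by
      rw [vanish_natSpan (fun a ha => hD a ha h hmem) hεS] at hεh
      norm_num at hεh
    have hD' : ∀ a ∈ S', ∀ d ∈ D ⊔ k ∙ h, a d = 0 := by
      intro a ha d' hd'
      obtain ⟨d, hd, e, he, rfl⟩ := Submodule.mem_sup.1 hd'
      obtain ⟨c, rfl⟩ := Submodule.mem_span_singleton.1 he
      have haR := G.base.subset (hS (hS'S.1 ha))
      rw [map_add, map_smul, hD a (hS'S.1 ha) d hd, hh a haR, hz0 a haR (mem_natSpan_self ha)]
      simp
    have hS'Δ := hS'S.1.trans hS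
    obtain ⟨m, hm, hind⟩ := ih S'.card (hn ▸ Finset.card_lt_card hS'S) S' hS'Δ _ hD' rfl
    have hrank : finrank k (D ⊔ k ∙ h : Submodule k H) = finrank k D + 1 := by
      have h1 := Submodule.finrank_sup_add_finrank_inf_eq D (k ∙ h)
      have h2 : D ⊓ k ∙ h = ⊥ := by
        rw [← disjoint_iff, Submodule.disjoint_span_singleton]
        exact fun hmem => absurd hmem hhD
      have h3 : finrank k (k ∙ h) = 1 := finrank_span_singleton (fun h0 => by
        rw [h0, map_zero] at hεh
        norm_num at hεh)
      rw [h2, finrank_bot, h3, add_zero] at h1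
      exact h1
    refine ⟨m, by omega, ?_⟩
    obtain ⟨z, hz, hz0⟩ := LG.ne ε hε
    have hεout : ε ∈ outRoots P Δ S' := mem_outRoots.2 ⟨hε, natSpan_mono hS hεS, hεS'⟩
    have hzb : z ∈ b := hle S' D (root_mem_bigIdeal hεout hz)
    have hzI : z ∉ bigIdeal P W Δ S D := by
      intro hmem
      have hle2 : bigIdeal P W Δ S D ≤ ⨆ (j) (_ : j ≠ ε), W j := by
        refine sup_le ?_ (iSup₂_le fun α hα => le_iSup₂_of_le α ?_ le_rfl)
        · refine le_iSup₂_of_le 0 (P.ne_zero ε hε).symm ?_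
          rw [LG.zero]
          rintro _ ⟨d, -, rfl⟩
          exact d.2
        · rintro rfl
          exact (mem_outRoots.1 hα).2.2 hεS
      exact hz0 (Submodule.disjoint_def.1 (LG.indep ε) z hz (hle2 hmem))
    have : Infinite k := CharZero.infinite k
    refine indexMod_reduce (subIn b (bigIdeal P W Δ S D))
      (subIn b (bigIdeal P W Δ S' (D ⊔ k ∙ h))) (fun x hx => bigIdeal_mono hS'S.1 le_sup_left hx)
      (hid S D hS hD) (hid S' _ hS'Δ hD') ⟨z, hzb⟩ hzI ?_ m hind
    intro f hf hfz x hx hxy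
    obtain ⟨F, hF⟩ := LinearMap.exists_extend (p := b.toSubmodule) f
    have hFf : ∀ y : b, F (y : g) = f y := fun y => LinearMap.congr_fun hF y
    refine step_nondeg G LG hS hS'S.1 hε hεS hεS' hΓ hD hh hz F ?_ ?_ hx ?_
    · intro y hy
      have := hf ⟨y, hle _ _ hy⟩ hy
      rwa [← hFf] at this
    · rw [← hFf] at hfz
      exact hfz
    · intro y hy
      have := hxy ⟨y, hle _ _ hy⟩ hy
      rwa [← hFf] at this
  · obtain rfl := Finset.not_nonempty_iff_eq_empty.1 hne
    have hDle : finrank k D ≤ finrank k H := Submodule.finrank_le D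
    refine ⟨finrank k H - finrank k D, ?_, ?_⟩
    · have : P.cascade ∅ = ∅ := Good.aux_empty _
      rw [this, Finset.card_empty]
      omega
    · have hbr : finrank k b = finrank k (bigIdeal P W Δ ∅ ⊤) := by rw [← hb]; rfl
      rw [finrank_bigIdeal LG, finrank_top] at hbr
      have hrk : ∀ f : Dual k b,
          (∀ x ∈ subIn b (bigIdeal P W Δ ∅ D), f x = 0) →
          finrank k (lieRad f) = finrank k H - finrank k D +
            finrank k (subIn b (bigIdeal P W Δ ∅ D)) := by
        intro f hf
        have htop : lieRad f = ⊤ := by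
          rw [eq_top_iff]
          intro x _ y
          apply hf
          obtain ⟨h, -, v, hv, hx⟩ := mem_bigIdeal.1 (hmemb x)
          obtain ⟨h', -, w, hw, hy⟩ := mem_bigIdeal.1 (hmemb y)
          show ⁅(x : g), (y : g)⁆ ∈ bigIdeal P W Δ ∅ D
          rw [hx, add_lie]
          have hsum : ∀ v : Dual k H → g, (∀ α, v α ∈ W α) →
              ∑ α ∈ outRoots P Δ ∅, v α ∈ bigIdeal P W Δ ∅ D := fun v hv =>
            Submodule.sum_mem _ fun α hα => root_mem_bigIdeal hα (hv α)
          refine Submodule.add_mem _ ?_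
            (bigIdeal_ideal G LG (Finset.empty_subset _) (by simp) (hsum v hv) (hmemb y))
          rw [hy, lie_add, LG.abel, zero_add, ← lie_skew]
          refine Submodule.neg_mem _ (bigIdeal_ideal G LG (Finset.empty_subset _) (by simp)
            (hsum w hw) (cartan_mem_bigIdeal trivial))
        rw [htop, finrank_top, hfr, finrank_bigIdeal LG, hbr]
        omega
      exact ⟨⟨0, by simp, hrk 0 (by simp)⟩, fun f hf => (hrk f hf).ge⟩

end LieInduction

section Bridge

open LieAlgebra LieAlgebra.IsKilling LieModule

variable {k g : Type*} [Field k] [IsAlgClosed k] [CharZero k]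
    [LieRing g] [LieAlgebra k g] [FiniteDimensional k g] [LieAlgebra.IsKilling k g]
    {H : LieSubalgebra k g} [H.IsCartanSubalgebra]
    {P : RootSystemData k (Module.Dual k H)}

/-- The root of the Killing Lie algebra attached to a root of `P`. -/
noncomputable def toRoot
    (hroots : ∀ α : Module.Dual k H, α ∈ P.roots ↔ α ≠ 0 ∧ rootSpace H ⇑α ≠ ⊥)
    (α : Dual k H) (h : α ∈ P.roots) : H.root :=
  ⟨⟨⇑α, ((hroots α).1 h).2⟩, by
    have h0 : α ≠ 0 := ((hroots α).1 h).1
    simp only [LieSubalgebra.root, Finset.mem_filter, Finset.mem_univ, true_and]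
    intro h1
    apply h0
    ext x
    exact congrFun h1 x⟩

variable (hroots : ∀ α : Module.Dual k H, α ∈ P.roots ↔ α ≠ 0 ∧ rootSpace H ⇑α ≠ ⊥)

lemma toRoot_apply (α : Dual k H) (h : α ∈ P.roots) (x : H) :
    (toRoot hroots α h).1 x = α x := rfl

lemma toRoot_coe (α : Dual k H) (h : α ∈ P.roots) :
    ⇑(toRoot hroots α h).1 = ⇑α := rfl

lemma toRoot_isNonZero (α : Dual k H) (h : α ∈ P.roots) :
    (toRoot hroots α h).1.IsNonZero := by
  exact (Finset.mem_filter.1 (toRoot hroots α h).2).2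

lemma toRoot_root (α : Dual k H) (h : α ∈ P.roots) :
    (rootSystem H).root (toRoot hroots α h) = α := by
  ext x
  simp [rootSystem_root_apply, toRoot_apply]

lemma weight_mem_roots
    (hroots : ∀ α : Module.Dual k H, α ∈ P.roots ↔ α ≠ 0 ∧ rootSpace H ⇑α ≠ ⊥)
    (w : Weight k H g) (hw : w.IsNonZero) : w.toLinear ∈ P.roots := by
  rw [hroots]
  refine ⟨?_, w.genWeightSpace_ne_bot⟩
  intro h
  apply hw
  ext x
  exact LinearMap.congr_fun h x

lemma root_mem_roots
    (hroots : ∀ α : Module.Dual k H, α ∈ P.roots ↔ α ≠ 0 ∧ rootSpace H ⇑α ≠ ⊥)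
    (i : H.root) : (rootSystem H).root i ∈ P.roots := by
  rw [rootSystem_root_apply]
  refine weight_mem_roots hroots _ ?_
  exact (Finset.mem_filter.1 i.2).2

lemma corootForm_eq (ε : Dual k H) (hε : ε ∈ P.roots) :
    P.corootForm ε = Dual.eval k H (coroot (toRoot hroots ε hε).1) := by
  refine Module.Dual.eq_of_preReflection_mapsTo (x := ε) P.roots.finite_toSet P.span_eq_top
    ?_ ?_ ?_ ?_
  · rw [← P.pair_compat ε hε ε hε, P.pair_self ε hε]; norm_num
  · intro β hβ
    have := P.reflect_mem ε hε β hβ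
    rw [preReflection_apply, ← P.pair_compat ε hε β hβ, Int.cast_smul_eq_zsmul]
    exact this
  · rw [Dual.eval_apply]
    exact root_apply_coroot (toRoot_isNonZero hroots ε hε)
  · intro β hβ
    have h := weight_mem_roots hroots _ (reflectRoot_isNonZero (toRoot hroots ε hε).1
      (toRoot hroots β hβ).1 (toRoot_isNonZero hroots β hβ))
    have e : preReflection ε (Dual.eval k H (coroot (toRoot hroots ε hε).1)) β =
      (reflectRoot (toRoot hroots ε hε).1 (toRoot hroots β hβ).1).toLinear := by
      ext x
      simp [preReflection_apply, reflectRoot, toRoot_apply]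
    rw [e]
    exact h

lemma pairInt_cast (α ε : Dual k H) (hα : α ∈ P.roots) (hε : ε ∈ P.roots) :
    (P.pairInt α ε : k) = α (coroot (toRoot hroots ε hε).1) := by
  rw [P.pair_compat ε hε α hα, corootForm_eq hroots ε hε, Dual.eval_apply]

lemma pairInt_eq (α ε : Dual k H) (hα : α ∈ P.roots) (hε : ε ∈ P.roots) :
    P.pairInt α ε =
      (rootSystem H).pairingIn ℤ (toRoot hroots α hα) (toRoot hroots ε hε) := by
  have h := (rootSystem H).algebraMap_pairingIn ℤ (toRoot hroots α hα) (toRoot hroots ε hε)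
  rw [rootSystem_pairing_apply, toRoot_apply, ← pairInt_cast hroots α ε hα hε] at h
  simpa using h.symm

lemma good_of_killing
    (hroots : ∀ α : Module.Dual k H, α ∈ P.roots ↔ α ≠ 0 ∧ rootSpace H ⇑α ≠ ⊥)
    {Δ : Finset (Dual k H)} (hbase : P.IsBase Δ) : P.Good Δ where
  base := hbase
  sub_mem := fun α hα β hβ h hne => by
    rw [pairInt_eq hroots α β hα hβ] at h
    have hne' : toRoot hroots α hα ≠ toRoot hroots β hβ := fun e => hne (by
      rw [← toRoot_root hroots α hα, e, toRoot_root hroots β hβ])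
    obtain ⟨i, hi⟩ := RootPairing.root_sub_root_mem_of_pairingIn_pos _ h hne'
    rw [toRoot_root, toRoot_root] at hi
    rw [← hi]
    exact root_mem_roots hroots i
  pos_symm := fun α hα β hβ h => by
    rw [pairInt_eq hroots α β hα hβ] at h
    rw [pairInt_eq hroots β α hβ hα]
    exact (RootPairing.zero_lt_pairingIn_iff' _ ℤ).1 h
  zero_symm := fun α hα β hβ h => by
    rw [pairInt_eq hroots α β hα hβ] at h
    rw [pairInt_eq hroots β α hβ hα]
    exact (RootPairing.pairingIn_eq_zero_iff _).1 h

lemma dim_of_killing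
    (hroots : ∀ α : Module.Dual k H, α ∈ P.roots ↔ α ≠ 0 ∧ rootSpace H ⇑α ≠ ⊥)
    (α : Dual k H) (hα : α ∈ P.roots) (x : g) (hx : x ∈ rootSpace H ⇑α)
    (y : g) (hy : y ∈ rootSpace H ⇑α) (h0 : x ≠ 0) : ∃ c : k, y = c • x := by
  have h1 := finrank_rootSpace_eq_one _ (toRoot_isNonZero hroots α hα)
  rw [toRoot_coe] at h1
  have hx0 : (⟨x, hx⟩ : rootSpace H ⇑α) ≠ 0 := fun e => h0 (congrArg Subtype.val e)
  obtain ⟨c, hc⟩ := (finrank_eq_one_iff_of_nonzero' _ hx0).1 h1 ⟨y, hy⟩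
  exact ⟨c, (congrArg Subtype.val hc).symm⟩

lemma nondeg_of_killing
    (hroots : ∀ α : Module.Dual k H, α ∈ P.roots ↔ α ≠ 0 ∧ rootSpace H ⇑α ≠ ⊥)
    (ε : Dual k H) (hε : ε ∈ P.roots) (α : Dual k H) (hα : α ∈ P.roots)
    (hεα : ε - α ∈ P.roots) (h1 : P.pairInt α ε = 1) (x : g) (hx : x ∈ rootSpace H ⇑α)
    (y : g) (hy : y ∈ rootSpace H ⇑(ε - α)) (hx0 : x ≠ 0) (hy0 : y ≠ 0) : ⁅x, y⁆ ≠ 0 := by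
  intro hxy
  have hnz := toRoot_isNonZero hroots ε hε
  obtain ⟨h, e, f, t, he, hf⟩ := exists_isSl2Triple_of_weight_isNonZero hnz
  have hh := t.h_eq_coroot hnz he hf
  have hhx : ⁅h, x⁆ = x := by
    have := lie_eq_smul_of_mem_rootSpace hx (coroot (toRoot hroots ε hε).1)
    rw [← pairInt_cast hroots α ε hα hε, h1] at this
    rw [hh]
    simpa using this
  have hu0 : ⁅f, x⁆ ≠ 0 := by
    intro h0
    have pv : t.symm.HasPrimitiveVectorWith x (-1 : k) :=
      ⟨hx0, by rw [neg_lie, hhx]; simp, h0⟩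
    obtain ⟨n, hn⟩ := pv.exists_nat
    have h2 : ((n + 1 : ℕ) : k) = 0 := by push_cast; rw [← hn]; ring
    exact Nat.succ_ne_zero n (Nat.cast_eq_zero.1 h2)
  have hu : ⁅f, x⁆ ∈ rootSpace H (-⇑(ε - α)) := by
    have h3 := lie_mem_genWeightSpace_of_mem_genWeightSpace hf hx
    have e1 : -⇑(toRoot hroots ε hε).1 + ⇑α = -⇑(ε - α) := by
      ext z
      simp [toRoot_apply]
      ring
    rwa [e1] at h3
  have hneg : -(ε - α) ∈ P.roots := by
    have := P.reflect_mem _ hεα _ hεα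
    rw [P.pair_self _ hεα] at this
    convert this using 1
    rw [two_zsmul]; abel
  have hker : y ∈ LinearMap.ker (killingForm k g) := by
    refine mem_ker_killingForm_of_mem_rootSpace_of_forall_rootSpace_neg k g H hy ?_
    intro z hz
    obtain ⟨c, rfl⟩ := dim_of_killing hroots _ hneg _ hu z hz hu0
    rw [map_smul]
    have h4 : killingForm k g y ⁅f, x⁆ = 0 := by
      rw [← lie_skew, map_neg]
      have h5 := LieModule.traceForm_apply_lie_apply k g g y x f
      have h6 : ⁅y, x⁆ = 0 := by rw [← lie_skew, hxy, neg_zero]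
      rw [h6, map_zero, LinearMap.zero_apply] at h5
      rw [neg_eq_zero]
      exact h5.symm
    rw [h4, smul_zero]
  rw [ker_killingForm_eq_bot, Submodule.mem_bot] at hker
  exact hy0 hker

lemma lieGood_of_killing
    (hroots : ∀ α : Module.Dual k H, α ∈ P.roots ↔ α ≠ 0 ∧ rootSpace H ⇑α ≠ ⊥)
    :
    LieGood H P (fun α : Dual k H => (rootSpace H ⇑α).toSubmodule) where
  abel := fun h h' => by
    have := trivial_lie_zero H H h h'
    exact congrArg Subtype.val this
  act := fun α h x hx => lie_eq_smul_of_mem_rootSpace hx h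
  lie := fun α β x hx y hy => lie_mem_genWeightSpace_of_mem_genWeightSpace hx hy
  zero := by
    have := rootSpace_zero_eq k g H
    ext x
    change x ∈ rootSpace H ⇑(0 : Dual k H) ↔ _
    rw [show ⇑(0 : Dual k H) = 0 from rfl, this]
    rfl
  bot := fun γ h0 h => by
    have : rootSpace H ⇑γ = ⊥ := by
      by_contra hne
      exact h ((hroots γ).2 ⟨h0, hne⟩)
    rw [this]; rfl
  indep := by
    have h1 := LieModule.iSupIndep_genWeightSpace k H g
    have h2 := LieSubmodule.iSupIndep_toSubmodule.2 h1
    exact h2.comp (f := fun α : Dual k H => ⇑α) DFunLike.coe_injective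
  dim := fun α hα x hx y hy h0 => dim_of_killing hroots α hα x hx y hy h0
  ne := fun α hα => by
    have := ((hroots α).1 hα).2
    rw [Ne, LieSubmodule.eq_bot_iff] at this
    push Not at this
    exact this
  coroot := fun ε hε => ⟨coroot (toRoot hroots ε hε).1, fun α hα =>
    (pairInt_cast hroots α ε hα hε).symm⟩
  nondeg := fun ε hε α hα hεα h1 x hx y hy hx0 hy0 =>
    nondeg_of_killing hroots ε hε α hα hεα h1 x hx y hy hx0 hy0

end Bridge

section LieTheory

open LieAlgebra

/-- Let `𝔤` be a finite-dimensional semisimple Lie algebra over an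
algebraically closed field `k` of characteristic `0`, with Cartan subalgebra `𝔥`, root
system `R ⊆ 𝔥*`, base `Π`, positive roots `R₊`, and Borel subalgebra
`𝔟 = 𝔥 ⊕ (⊕_{α ∈ R₊} 𝔤^α)`.  Then the index of `𝔟`, i.e. the minimum of
`dim 𝔟^f` over all `f ∈ 𝔟*`, equals `rk 𝔤 - k_𝔤 = dim 𝔥 - |𝒦(Π)|`. -/
theorem index_of_borel_eq_rank_sub_cascade_card
    (k g : Type*) [Field k] [IsAlgClosed k] [CharZero k]
    [LieRing g] [LieAlgebra k g] [FiniteDimensional k g] [LieAlgebra.IsSemisimple k g]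
    (H : LieSubalgebra k g) [H.IsCartanSubalgebra]
    (P : RootSystemData k (Module.Dual k H))
    (hroots : ∀ α : Module.Dual k H, α ∈ P.roots ↔ α ≠ 0 ∧ rootSpace H ⇑α ≠ ⊥)
    (Δ : Finset (Module.Dual k H)) (hbase : P.IsBase Δ)
    (b : LieSubalgebra k g)
    (hb : b.toSubmodule = H.toSubmodule ⊔ ⨆ α ∈ P.posRoots Δ, (rootSpace H ⇑α).toSubmodule) :
    IsLeast {n : ℕ | ∃ f : Module.Dual k b, n = Module.finrank k ↥(lieSubFix b f)}
      (Module.finrank k ↥H - (P.cascade Δ).card) := by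
  have G := good_of_killing hroots hbase
  have LG := lieGood_of_killing hroots
  have hout : outRoots P Δ ∅ = P.posRoots Δ := by
    ext α
    constructor
    · intro h
      have h' := mem_outRoots.1 h
      exact Finset.mem_filter.2 ⟨h'.1, h'.2.1⟩
    · intro h
      have h' := Finset.mem_filter.1 h
      exact mem_outRoots_empty h'.1 h'.2
  have hb' : b.toSubmodule = bigIdeal P
      (fun α : Module.Dual k H => (rootSpace H ⇑α).toSubmodule) Δ ∅ ⊤ := by
    rw [hb, bigIdeal, hout]
    congr 1
    exact (Submodule.map_subtype_top _).symm
  obtain ⟨m, hm, ⟨f, hf0, hf⟩, hlow⟩ :=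
    main_induction G LG b hb' Δ subset_rfl ⊥ (fun a _ d hd => by
      rw [(Submodule.mem_bot k).1 hd, map_zero])
  have hbig : subIn b (bigIdeal P
      (fun α : Module.Dual k H => (rootSpace H ⇑α).toSubmodule) Δ Δ ⊥) = ⊥ := by
    have h0 : outRoots P Δ Δ = ∅ := by
      ext α
      simp only [mem_outRoots, Finset.notMem_empty, iff_false]
      tauto
    rw [eq_bot_iff]
    intro x hx
    rw [mem_subIn, bigIdeal, h0] at hx
    simpa using hx
  rw [hbig] at hlow hf hf0
  rw [finrank_bot] at hm hf hlow
  have hm' : Module.finrank k ↥H - (P.cascade Δ).card = m := by omega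
  rw [hm']
  constructor
  · exact ⟨f, hf.symm⟩
  · rintro n ⟨f', rfl⟩
    have := hlow f' (fun x hx => by rw [(Submodule.mem_bot k).1 hx, map_zero])
    exact this

end LieTheory
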